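/- arXiv:1610.07295 — 2 statements merged into one kernel-verified Lean document; each statement's English description precedes it below -/
import Mathlib

section
/- Let U ⊆ ℂⁿ be open, f : U → ℂ holomorphic, and x ∈ U with f(x) = 0 and with the germ of f at x nonzero. Then for all real numbers 0 < β ≤ α, multiplication by the germ of f maps 𝒥(f^β)_x into 𝒥(f^{β+1})_x and 𝒥(f^α)_x into 𝒥(f^{α+1})_x, and it induces an isomorphism of modules over the local ring of holomorphic germs at x: 𝒥(f^β)_x/𝒥(f^α)_x ≅ 𝒥(f^{β+1})_x/𝒥(f^{α+1})_x. -/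
open MeasureTheory Filter Topology

noncomputable section

variable {E : Type*} [NormedAddCommGroup E] [NormedSpace ℂ E] [MeasureSpace E]

/-- `g` is holomorphic on some open neighborhood of `x`. -/
def HolNear (g : E → ℂ) (x : E) : Prop :=
  ∃ W : Set E, IsOpen W ∧ x ∈ W ∧ DifferentiableOn ℂ g W

/-- `g` satisfies the multiplier condition for `(f, α)` at `x`, where `U` is the domain of the
holomorphic function `f`: on some open neighborhood `V ∋ x` contained in the domains of `f` and
`g`, the function `|g|²/|f|^{2α}` is Lebesgue integrable. -/
def MultCond (f : E → ℂ) (U : Set E) (g : E → ℂ) (x : E) (α : ℝ) : Prop :=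
  ∃ V : Set E, IsOpen V ∧ x ∈ V ∧ V ⊆ U ∧ DifferentiableOn ℂ g V ∧
    IntegrableOn (fun y => ‖g y‖ ^ 2 / ‖f y‖ ^ (2 * α)) V volume

/-- `α` is a jumping coefficient of `f` at `x`. -/
def JumpCoeff (f : E → ℂ) (U : Set E) (x : E) (α : ℝ) : Prop :=
  ∃ g : E → ℂ, HolNear g x ∧ (∀ α' : ℝ, α' < α → MultCond f U g x α') ∧ ¬ MultCond f U g x α

/-- the log canonical threshold of `f` at `x`. -/
def Lct (f : E → ℂ) (U : Set E) (x : E) : ℝ :=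
  sSup {α : ℝ | 0 ≤ α ∧ MultCond f U (fun _ => 1) x α}

section

open Metric

theorem not_integrableOn_inv_norm_sub_sq (a : ℂ) {r : ℝ} (hr : 0 < r) :
    ¬ IntegrableOn (fun z : ℂ => (‖z - a‖ ^ 2)⁻¹) (ball a r) := by
  intro h
  have h0 : IntegrableOn (fun z : ℂ => (‖z‖ ^ 2)⁻¹) (ball 0 r) := by
    have hmp := measurePreserving_add_right (volume : Measure ℂ) a
    have := (hmp.integrableOn_comp_preimage (MeasurableEquiv.addRight a).measurableEmbedding).2 h
    have hpre : (fun z : ℂ => z + a) ⁻¹' ball a r = ball 0 r := by ext; simp [dist_eq_norm]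
    rw [hpre] at this
    simpa [Function.comp_def] using this
  rw [integrableOn_fun_norm_addHaar volume (f := fun y : ℝ => (y ^ 2)⁻¹)] at h0
  have h1 : IntegrableOn (fun y : ℝ => y ^ (-1 : ℝ)) (Set.Ioo 0 r) := by
    refine h0.congr_fun (fun y hy => ?_) measurableSet_Ioo
    have : y ≠ 0 := hy.1.ne'
    simp only [Complex.finrank_real_complex, smul_eq_mul, Real.rpow_neg_one, Nat.add_one_sub_one]
    field_simp
  rw [intervalIntegral.integrableOn_Ioo_rpow_iff hr] at h1
  exact lt_irrefl _ h1

/-- A square-integrable meromorphic function has no pole. -/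
theorem MeromorphicAt.meromorphicOrderAt_nonneg_of_integrableOn_sq {H : ℂ → ℂ} {a : ℂ}
    {s : Set ℂ} (hH : MeromorphicAt H a) (hs : s ∈ 𝓝 a)
    (hint : IntegrableOn (fun z => ‖H z‖ ^ 2) s) : 0 ≤ meromorphicOrderAt H a := by
  by_contra! hneg
  have hsub : MeromorphicAt (fun z : ℂ => z - a) a := by fun_prop
  have hord : 0 ≤ meromorphicOrderAt ((fun z : ℂ => z - a) * H)⁻¹ a := by
    rw [meromorphicOrderAt_inv, meromorphicOrderAt_mul hsub hH,
      meromorphicOrderAt_id_sub_const]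
    lift meromorphicOrderAt H a to ℤ using hneg.ne_top with k
    have hk : k < 0 := by exact_mod_cast hneg
    exact WithTop.coe_le_coe.2 (by omega : (0 : ℤ) ≤ -(1 + k))
  obtain ⟨c, hc⟩ := tendsto_nhds_of_meromorphicOrderAt_nonneg (hsub.mul hH).inv hord
  have hbd : ∀ᶠ z in 𝓝[≠] a, ‖((z - a) * H z)⁻¹‖ < ‖c‖ + 1 :=
    (hc.norm).eventually_lt_const (lt_add_one _)
  have hne : ∀ᶠ z in 𝓝[≠] a, H z ≠ 0 :=
    (tendsto_cobounded_of_meromorphicOrderAt_neg hneg).eventually_ne_cobounded 0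
  have hall : ∀ᶠ z in 𝓝[≠] a, (‖z - a‖ ^ 2)⁻¹ ≤ (‖c‖ + 1) ^ 2 * ‖H z‖ ^ 2 := by
    filter_upwards [hbd, hne] with z hz hz0
    have hpos : 0 < ‖H z‖ := norm_pos_iff.2 hz0
    have h1 : ‖z - a‖⁻¹ ≤ (‖c‖ + 1) * ‖H z‖ := by
      rw [norm_inv, norm_mul, mul_inv, ← div_eq_mul_inv, div_lt_iff₀ hpos] at hz
      exact hz.le
    calc (‖z - a‖ ^ 2)⁻¹ = (‖z - a‖⁻¹) ^ 2 := by rw [inv_pow]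
      _ ≤ ((‖c‖ + 1) * ‖H z‖) ^ 2 := by gcongr
      _ = _ := by ring
  rw [eventually_nhdsWithin_iff] at hall
  obtain ⟨ρ, hρ, hball⟩ := Metric.mem_nhds_iff.1 (inter_mem hs hall)
  refine not_integrableOn_inv_norm_sub_sq a hρ ?_
  refine Integrable.mono' (((hint.mono_set fun z hz => (hball hz).1).const_mul ((‖c‖ + 1) ^ 2)))
    (by fun_prop) ?_
  have hae : ∀ᵐ z ∂(volume.restrict (ball a ρ)), z ≠ a :=
    ae_restrict_of_ae (Measure.ae_ne volume a)
  filter_upwards [hae, ae_restrict_mem measurableSet_ball] with z hz hzb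
  rw [Real.norm_of_nonneg (by positivity)]
  exact (hball hzb).2 hz

/-- If `G / F` is square-integrable on a disc, then `F` divides `G` there, and the value of the
quotient at the center is the mean of `G / F` over the boundary circle. -/
theorem mul_circleAverage_div_eq_of_integrableOn_sq {F G : ℂ → ℂ} {Ω : Set ℂ} (hΩ : IsOpen Ω)
    (hF : DifferentiableOn ℂ F Ω) (hG : DifferentiableOn ℂ G Ω) {c : ℂ} {r : ℝ} (hr : 0 < r)
    (hsub : closedBall c r ⊆ Ω) (hne : ∀ t ∈ sphere c r, F t ≠ 0)
    (hint : IntegrableOn (fun t => ‖G t / F t‖ ^ 2) (ball c r)) :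
    F c * Real.circleAverage (fun t => G t / F t) c r = G c := by
  have hFan : AnalyticOnNhd ℂ F (closedBall c r) := (hF.analyticOnNhd hΩ).mono hsub
  have hGan : AnalyticOnNhd ℂ G (closedBall c r) := (hG.analyticOnNhd hΩ).mono hsub
  have hmer : MeromorphicOn (G / F) (closedBall c r) := fun z hz =>
    (hGan z hz).meromorphicAt.div (hFan z hz).meromorphicAt
  set K := toMeromorphicNFOn (G / F) (closedBall c r) with hK
  have hKan : AnalyticOnNhd ℂ K (closedBall c r) := by
    intro z hz
    rw [← (meromorphicNFOn_toMeromorphicNFOn (G / F) (closedBall c r)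
      hz).meromorphicOrderAt_nonneg_iff_analyticAt, meromorphicOrderAt_toMeromorphicNFOn hmer hz]
    rcases (mem_closedBall.1 hz).lt_or_eq with h | h
    · exact (hmer z hz).meromorphicOrderAt_nonneg_of_integrableOn_sq (isOpen_ball.mem_nhds h) hint
    · exact ((hGan z hz).div (hFan z hz) (hne z h)).meromorphicOrderAt_nonneg
  have hc : c ∈ closedBall c r := mem_closedBall_self hr.le
  have havg : Real.circleAverage (fun t => G t / F t) c r = K c := by
    have h1 : Real.circleAverage K c r = K c := by
      refine circleAverage_of_differentiable_on_off_countable (s := ∅) Set.countable_empty ?_ ?_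
      · rw [abs_of_pos hr]; exact hKan.continuousOn
      · rw [abs_of_pos hr]
        exact fun z hz => (hKan z (ball_subset_closedBall hz.1)).differentiableAt
    rw [← h1]
    refine Real.circleAverage_congr_sphere fun z hz => ?_
    rw [abs_of_pos hr] at hz
    have hz' := sphere_subset_closedBall hz
    rw [hK, toMeromorphicNFOn_eq_toMeromorphicNFAt hmer hz', toMeromorphicNFAt_eq_self.2
      ((hGan z hz').div (hFan z hz') (hne z hz)).meromorphicNFAt]
    rfl
  have hFne : ∀ᶠ z in 𝓝[≠] c, F z ≠ 0 := by
    rcases (hFan c hc).eventually_eq_zero_or_eventually_ne_zero with h | h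
    · obtain ⟨t, ht⟩ := (NormedSpace.sphere_nonempty (x := c) (r := r)).2 hr.le
      exact absurd (hFan.eqOn_zero_of_preconnected_of_eventuallyEq_zero
        (convex_closedBall c r).isPreconnected hc h (sphere_subset_closedBall ht)) (hne t ht)
    · exact h
  have heq : ∀ᶠ z in 𝓝[≠] c, F z * K z = G z := by
    filter_upwards [hFne, hmer.toMeromorphicNFOn_eq_self_on_nhdsNE hc] with z hz hz'
    rw [hK, hz', Pi.div_apply, mul_div_cancel₀ _ hz]
  have heq' : (fun z => F z * K z) =ᶠ[𝓝 c] G :=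
    (((hFan c hc).continuousAt.mul
      (hKan c hc).continuousAt).eventuallyEq_nhds_iff_eventuallyEq_nhdsNE
        (hGan c hc).continuousAt).1 heq
  rw [havg]
  exact heq'.eq_of_nhds

/-- Circle averages of a holomorphic function along parallel complex lines depend holomorphically
on the center. -/
theorem differentiableOn_circleAverage_add_smul {X : Type*}
    [NormedAddCommGroup X] [NormedSpace ℂ X] [FiniteDimensional ℂ X] {h : X → ℂ} {O : Set X}
    (hO : IsOpen O) (hh : DifferentiableOn ℂ h O) {x v : X} {r : ℝ} (hr : 0 ≤ r)
    (hx : ∀ t ∈ sphere (0 : ℂ) r, x + t • v ∈ O) :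
    ∃ δ > 0, DifferentiableOn ℂ
      (fun z => Real.circleAverage (fun t : ℂ => h (z + t • v)) 0 r) (ball x δ) := by
  borelize X
  have : ProperSpace X := FiniteDimensional.proper ℂ X
  have : ProperSpace (X →L[ℂ] ℂ) := FiniteDimensional.proper ℂ (X →L[ℂ] ℂ)
  have hS : IsCompact ((fun t : ℂ => x + t • v) '' sphere 0 r) :=
    (isCompact_sphere 0 r).image (by fun_prop)
  obtain ⟨δ, hδ, hδO⟩ := hS.exists_cthickening_subset_open hO
    (by rintro _ ⟨t, ht, rfl⟩; exact hx t ht)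
  obtain ⟨C, hC⟩ := (hS.cthickening (r := δ)).exists_bound_of_continuousOn
    (hh.continuousOn.mono hδO)
  have hmem : ∀ z ∈ ball x (δ / 2), ∀ θ : ℝ, ∀ y ∈ ball (z + circleMap 0 r θ • v) (δ / 2),
      y ∈ cthickening δ ((fun t : ℂ => x + t • v) '' sphere 0 r) := by
    intro z hz θ y hy
    refine mem_cthickening_of_dist_le y (x + circleMap 0 r θ • v) δ _
      ⟨_, circleMap_mem_sphere 0 hr θ, rfl⟩ ?_
    calc dist y (x + circleMap 0 r θ • v)
        ≤ dist y (z + circleMap 0 r θ • v)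
          + dist (z + circleMap 0 r θ • v) (x + circleMap 0 r θ • v) := dist_triangle _ _ _
      _ ≤ δ / 2 + δ / 2 := by
        rw [dist_add_right]
        exact add_le_add (mem_ball.1 hy).le (mem_ball.1 hz).le
      _ = δ := add_halves δ
  have hmem' : ∀ z ∈ ball x (δ / 2), ∀ θ : ℝ, z + circleMap 0 r θ • v ∈ O := fun z hz θ =>
    hδO (hmem z hz θ _ (mem_ball_self (half_pos hδ)))
  have hcont : ∀ z ∈ ball x (δ / 2), Continuous fun θ : ℝ => h (z + circleMap 0 r θ • v) :=
    fun z hz => hh.continuousOn.comp_continuous (by fun_prop) (hmem' z hz)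
  refine ⟨δ / 2, half_pos hδ, fun z₀ hz₀ => DifferentiableAt.differentiableWithinAt ?_⟩
  simp only [Real.circleAverage_def, intervalIntegral.integral_of_le Real.two_pi_pos.le]
  refine DifferentiableAt.const_smul (HasFDerivAt.differentiableAt
    (hasFDerivAt_integral_of_dominated_of_fderiv_le
      (F' := fun z θ => fderiv ℂ h (z + circleMap 0 r θ • v)) (bound := fun _ => 2 * C / (δ / 2))
      (isOpen_ball.mem_nhds hz₀) ?_ ?_ ?_ ?_ ?_ ?_)) _
  · filter_upwards [isOpen_ball.mem_nhds hz₀] with z hz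
    exact (hcont z hz).aestronglyMeasurable
  · exact ((hcont z₀ hz₀).integrableOn_Icc).mono_set Set.Ioc_subset_Icc_self
  · exact ((measurable_fderiv ℂ h).comp
      (by fun_prop : Continuous fun θ : ℝ => z₀ + circleMap 0 r θ • v).measurable)
      |>.aestronglyMeasurable
  · refine Eventually.of_forall fun θ z hz => ?_
    refine Complex.norm_fderiv_le_div_of_mapsTo_ball
      (hh.mono fun y hy => hδO (hmem z hz θ y hy)) (fun y hy => ?_) (half_pos hδ)
    rw [mem_closedBall, dist_eq_norm, two_mul]
    exact (norm_sub_le _ _).trans (add_le_add (hC _ (hmem z hz θ y hy))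
      (hC _ (hmem z hz θ _ (mem_ball_self (half_pos hδ)))))
  · exact integrable_const _
  · refine Eventually.of_forall fun θ z hz => ?_
    exact (hasFDerivAt_comp_add_right _).2
      (hh.differentiableAt (hO.mem_nhds (hmem' z hz θ))).hasFDerivAt

/-- A holomorphic function with nonzero germ at `x` has nonzero germ along some complex line
through `x`. -/
theorem exists_not_eventuallyEq_zero_comp_add_smul {X : Type*} [NormedAddCommGroup X]
    [NormedSpace ℂ X] {f : X → ℂ} {V : Set X} (hf : DifferentiableOn ℂ f V) {x : X}
    (hV : V ∈ 𝓝 x) (hne : ¬ f =ᶠ[𝓝 x] 0) :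
    ∃ v : X, ¬ (fun t : ℂ => f (x + t • v)) =ᶠ[𝓝 0] 0 := by
  by_contra! hall
  obtain ⟨ρ, hρ, hball⟩ := Metric.mem_nhds_iff.1 hV
  refine hne ?_
  filter_upwards [ball_mem_nhds x hρ] with y hy
  set L : ℂ → X := fun t => x + t • (y - x) with hL
  have hLd : Differentiable ℂ L := by fun_prop
  have hopen : IsOpen (L ⁻¹' ball x ρ) := isOpen_ball.preimage hLd.continuous
  have hconv : Convex ℝ (L ⁻¹' ball x ρ) := by
    intro s hs t ht a b ha hb hab
    have : L (a • s + b • t) = a • L s + b • L t := by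
      simp only [hL, smul_add, add_smul, smul_assoc]
      rw [add_add_add_comm, ← add_smul, hab, one_smul]
    rw [Set.mem_preimage, this]
    exact convex_ball x ρ hs ht ha hb hab
  have han : AnalyticOnNhd ℂ (fun t => f (L t)) (L ⁻¹' ball x ρ) :=
    DifferentiableOn.analyticOnNhd
      ((hf.mono hball).comp hLd.differentiableOn fun t ht => ht) hopen
  have h0 : (0 : ℂ) ∈ L ⁻¹' ball x ρ := by simp [hL, hρ]
  have h1 : (1 : ℂ) ∈ L ⁻¹' ball x ρ := by simpa [hL] using hy
  have := han.eqOn_zero_of_preconnected_of_eventuallyEq_zero hconv.isPreconnected h0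
    (hall (y - x)) h1
  simpa [hL] using this

/-- An integrable function is integrable along almost every translate of a piece of a complex
line. -/
theorem MeasureTheory.Integrable.ae_integrableOn_comp_add_smul {X : Type*} [NormedAddCommGroup X]
    [NormedSpace ℂ X] [FiniteDimensional ℂ X] [MeasurableSpace X] [BorelSpace X] {μ : Measure X}
    [μ.IsAddHaarMeasure] {φ : X → ℝ} (hφ : Integrable φ μ) (v : X) (s : Set ℂ)
    (hs : volume s ≠ ⊤) :
    ∀ᵐ z ∂μ, IntegrableOn (fun t : ℂ => φ (z + t • v)) s := by
  have : ProperSpace X := FiniteDimensional.proper ℂ X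
  have : IsFiniteMeasure (volume.restrict s) := ⟨by simpa using hs.lt_top⟩
  have hmp : MeasurePreserving (fun p : ℂ × X => (p.1, p.2 + p.1 • v))
      ((volume.restrict s).prod μ) ((volume.restrict s).prod μ) :=
    MeasurePreserving.skew_product (MeasurePreserving.id _)
      (g := fun (t : ℂ) (z : X) => z + t • v)
      (by unfold Function.uncurry; fun_prop)
      (Eventually.of_forall fun t => map_add_right_eq_self μ (t • v))
  exact (hmp.integrable_comp_of_integrable (hφ.comp_snd (volume.restrict s))).prod_left_ae

/-- If `g / f` is locally square-integrable, then the germ of `f` divides the germ of `g`. -/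
theorem exists_differentiableOn_mul_eq_of_integrableOn_sq {X : Type*} [NormedAddCommGroup X]
    [NormedSpace ℂ X] [FiniteDimensional ℂ X] [MeasurableSpace X] [BorelSpace X] (μ : Measure X)
    [μ.IsAddHaarMeasure] {f g : X → ℂ} {V : Set X} (hV : IsOpen V)
    (hf : DifferentiableOn ℂ f V) (hg : DifferentiableOn ℂ g V) {x : X} (hx : x ∈ V)
    (hne : ¬ f =ᶠ[𝓝 x] 0) (hint : IntegrableOn (fun y => ‖g y / f y‖ ^ 2) V μ) :
    ∃ δ > 0, ∃ q : X → ℂ, ball x δ ⊆ V ∧ DifferentiableOn ℂ q (ball x δ) ∧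
      ∀ y ∈ ball x δ, f y * q y = g y := by
  obtain ⟨v, hv⟩ := exists_not_eventuallyEq_zero_comp_add_smul hf (hV.mem_nhds hx) hne
  have hline : ∀ z : X, Differentiable ℂ fun t : ℂ => z + t • v := fun z => by fun_prop
  have hopen : ∀ z : X, IsOpen ((fun t : ℂ => z + t • v) ⁻¹' V) := fun z =>
    hV.preimage (hline z).continuous
  have hslice : ∀ {k : X → ℂ}, DifferentiableOn ℂ k V → ∀ z : X,
      DifferentiableOn ℂ (fun t : ℂ => k (z + t • v)) ((fun t : ℂ => z + t • v) ⁻¹' V) :=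
    fun hk z => hk.comp (hline z).differentiableOn fun t ht => ht
  have h0 : (0 : ℂ) ∈ (fun t : ℂ => x + t • v) ⁻¹' V := by simpa using hx
  have hpunct : ∀ᶠ t in 𝓝[≠] (0 : ℂ), f (x + t • v) ≠ 0 :=
    ((hslice hf x).analyticOnNhd (hopen x) 0
      h0).eventually_eq_zero_or_eventually_ne_zero.resolve_left hv
  rw [eventually_nhdsWithin_iff] at hpunct
  obtain ⟨r, hr, hrsub⟩ := Metric.nhds_basis_closedBall.mem_iff.1
    (inter_mem ((hopen x).mem_nhds h0) hpunct)
  set O : Set X := V ∩ f ⁻¹' {0}ᶜ with hO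
  have hOopen : IsOpen O := hf.continuousOn.isOpen_inter_preimage hV isOpen_compl_singleton
  have hsphere : ∀ t ∈ sphere (0 : ℂ) r, x + t • v ∈ O := fun t ht =>
    ⟨(hrsub (sphere_subset_closedBall ht)).1,
      (hrsub (sphere_subset_closedBall ht)).2 (ne_of_mem_sphere ht hr.ne')⟩
  have hq : DifferentiableOn ℂ (fun y => g y / f y) O := by
    simp only [div_eq_mul_inv]
    exact (hg.mono Set.inter_subset_left).mul
      ((hf.mono Set.inter_subset_left).inv fun y hy => hy.2)
  obtain ⟨δ₁, hδ₁, hdiff⟩ := differentiableOn_circleAverage_add_smul hOopen hq hr.le hsphere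
  have hnear : ∀ {W : Set X}, IsOpen W → ∀ {s : Set ℂ}, IsCompact s →
      (∀ t ∈ s, x + t • v ∈ W) → ∀ᶠ z in 𝓝 x, ∀ t ∈ s, z + t • v ∈ W := by
    intro W hW s hs hsW
    refine hs.eventually_forall_of_forall_eventually fun t ht => ?_
    exact (by fun_prop : Continuous fun p : X × ℂ => p.1 + p.2 • v).continuousAt.eventually
      (hW.mem_nhds (hsW t ht))
  obtain ⟨δ, hδ, hball⟩ := Metric.mem_nhds_iff.1 (inter_mem (inter_mem (hV.mem_nhds hx)
    (ball_mem_nhds x hδ₁)) (inter_mem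
      (hnear hV (isCompact_closedBall (0 : ℂ) r) fun t ht => (hrsub ht).1)
      (hnear hOopen (isCompact_sphere (0 : ℂ) r) hsphere)))
  set q : X → ℂ := fun z =>
    Real.circleAverage (fun t : ℂ => g (z + t • v) / f (z + t • v)) 0 r with hqdef
  have hqd : DifferentiableOn ℂ q (ball x δ) := hdiff.mono fun z hz => (hball hz).1.2
  refine ⟨δ, hδ, q, fun z hz => (hball hz).1.1, hqd, ?_⟩
  have hsub : ball x δ ⊆ V := fun z hz => (hball hz).1.1
  have hae : ∀ᵐ z ∂(μ.restrict (ball x δ)), f z * q z = g z := by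
    have hφ : Integrable (V.indicator fun y => ‖g y / f y‖ ^ 2) μ :=
      (integrable_indicator_iff hV.measurableSet).2 hint
    filter_upwards [ae_restrict_of_ae
      (hφ.ae_integrableOn_comp_add_smul v (ball 0 r) measure_ball_lt_top.ne),
      ae_restrict_mem measurableSet_ball] with z hz hzb
    have hz' : IntegrableOn (fun t : ℂ => ‖g (z + t • v) / f (z + t • v)‖ ^ 2) (ball 0 r) :=
      hz.congr_fun (fun t ht => Set.indicator_of_mem
        ((hball hzb).2.1 t (ball_subset_closedBall ht)) _) measurableSet_ball
    simpa using mul_circleAverage_div_eq_of_integrableOn_sq (hopen z) (hslice hf z) (hslice hg z)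
      hr (fun t ht => (hball hzb).2.1 t ht) (fun t ht => ((hball hzb).2.2 t ht).2) hz'
  exact Measure.eqOn_open_of_ae_eq hae isOpen_ball
    ((hf.mono hsub).continuousOn.mul hqd.continuousOn) (hg.mono hsub).continuousOn

theorem norm_mul_sq_div_rpow_add_one (a b : ℂ) {α : ℝ} (hα : 0 < α) :
    ‖a * b‖ ^ 2 / ‖a‖ ^ (2 * (α + 1)) = ‖b‖ ^ 2 / ‖a‖ ^ (2 * α) := by
  rcases eq_or_ne a 0 with rfl | ha
  · simp [Real.zero_rpow (by positivity : 2 * α ≠ 0)]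
  · have hpos : 0 < ‖a‖ := norm_pos_iff.2 ha
    have hpow : ‖a‖ ^ (2 * (α + 1)) = ‖a‖ ^ (2 * α) * ‖a‖ ^ 2 := by
      rw [mul_add, Real.rpow_add hpos, mul_one, Real.rpow_two]
    have := (Real.rpow_pos_of_pos hpos (2 * α)).ne'
    rw [hpow, norm_mul]
    field_simp

theorem MultCond.mul_left {f g : E → ℂ} {U : Set E} {x : E} {α : ℝ} (hα : 0 < α)
    (hf : DifferentiableOn ℂ f U) (h : MultCond f U g x α) :
    MultCond f U (fun y => f y * g y) x (α + 1) := by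
  obtain ⟨V, hV, hxV, hVU, hg, hint⟩ := h
  refine ⟨V, hV, hxV, hVU, (hf.mono hVU).mul hg, ?_⟩
  simpa only [norm_mul_sq_div_rpow_add_one _ _ hα] using hint

theorem MultCond.of_mul_left {f g : E → ℂ} {U : Set E} {x : E} {α : ℝ} (hα : 0 < α)
    (hg : HolNear g x) (h : MultCond f U (fun y => f y * g y) x (α + 1)) :
    MultCond f U g x α := by
  obtain ⟨V, hV, hxV, hVU, -, hint⟩ := h
  obtain ⟨W, hW, hxW, hgW⟩ := hg
  refine ⟨V ∩ W, hV.inter hW, ⟨hxV, hxW⟩, Set.inter_subset_left.trans hVU,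
    hgW.mono Set.inter_subset_right, ?_⟩
  simp only [norm_mul_sq_div_rpow_add_one _ _ hα] at hint
  exact hint.mono_set Set.inter_subset_left

/-- The weight `|f|^{-2(β+1)}` dominates `|f|^{-2}` near a zero of `f`, so a germ in the
multiplier ideal of exponent `β + 1` is square-integrable after division by `f`. -/
theorem MultCond.exists_integrableOn_norm_div_sq [BorelSpace E] {f g : E → ℂ} {U : Set E} {x : E}
    {β : ℝ} (hβ : 0 < β) (hf : DifferentiableOn ℂ f U) (hf0 : f x = 0)
    (h : MultCond f U g x (β + 1)) :
    ∃ V : Set E, IsOpen V ∧ x ∈ V ∧ V ⊆ U ∧ DifferentiableOn ℂ g V ∧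
      IntegrableOn (fun y => ‖g y / f y‖ ^ 2) V volume := by
  obtain ⟨V, hV, hxV, hVU, hg, hint⟩ := h
  have hfV := hf.mono hVU
  set V' : Set E := V ∩ f ⁻¹' ball 0 1 with hV'
  have hopen : IsOpen V' := hfV.continuousOn.isOpen_inter_preimage hV isOpen_ball
  have hsub : V' ⊆ V := Set.inter_subset_left
  refine ⟨V', hopen, ⟨hxV, by simp [hf0]⟩, hsub.trans hVU, hg.mono hsub, ?_⟩
  have hmeas : AEStronglyMeasurable (fun y => ‖g y / f y‖ ^ 2) (volume.restrict V') := by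
    have hgm := ((hg.mono hsub).continuousOn.aemeasurable (μ := volume) hopen.measurableSet)
    have hfm := ((hfV.mono hsub).continuousOn.aemeasurable (μ := volume) hopen.measurableSet)
    exact ((hgm.div hfm).norm.pow_const 2).aestronglyMeasurable
  refine (hint.mono_set hsub).mono' hmeas ?_
  filter_upwards [ae_restrict_mem hopen.measurableSet] with y hy
  rw [Real.norm_of_nonneg (by positivity), norm_div, div_pow]
  rcases eq_or_ne (f y) 0 with h0 | h0
  · simp only [h0, norm_zero, ne_eq, OfNat.ofNat_ne_zero, not_false_eq_true, zero_pow, div_zero]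
    positivity
  · have hpos : 0 < ‖f y‖ := norm_pos_iff.2 h0
    have hle : ‖f y‖ ≤ 1 := (mem_ball_zero_iff.1 hy.2).le
    gcongr
    rw [← Real.rpow_two]
    exact Real.rpow_le_rpow_of_exponent_ge hpos hle (by linarith)

end

/-- Germ-level version of (2.1.4): for `0 < β ≤ α`, multiplication by the germ of `f` maps
`𝒥(f^β)_x` into `𝒥(f^{β+1})_x` (and `𝒥(f^α)_x` into `𝒥(f^{α+1})_x`) and induces an
isomorphism `𝒥(f^β)_x/𝒥(f^α)_x ≅ 𝒥(f^{β+1})_x/𝒥(f^{α+1})_x`, expressed elementwise: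
it is well defined, injective and surjective modulo the respective subideals. -/
theorem multiplication_by_f_induces_iso
    {n : ℕ} (hn : 1 ≤ n)
    (U : Set (Fin n → ℂ)) (hU : IsOpen U)
    (f : (Fin n → ℂ) → ℂ) (hf : DifferentiableOn ℂ f U)
    (x : Fin n → ℂ) (hx : x ∈ U) (hf0 : f x = 0) (hne : ¬ (f =ᶠ[𝓝 x] 0))
    (β α : ℝ) (hβ : 0 < β) (hβα : β ≤ α) :
    -- multiplication by `f` maps `𝒥(f^β)_x` into `𝒥(f^{β+1})_x` ...
    (∀ g : (Fin n → ℂ) → ℂ, HolNear g x → MultCond f U g x β →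
      MultCond f U (fun y => f y * g y) x (β + 1)) ∧
    -- ... and `𝒥(f^α)_x` into `𝒥(f^{α+1})_x`;
    (∀ g : (Fin n → ℂ) → ℂ, HolNear g x → MultCond f U g x α →
      MultCond f U (fun y => f y * g y) x (α + 1)) ∧
    -- induced map `𝒥(f^β)_x/𝒥(f^α)_x → 𝒥(f^{β+1})_x/𝒥(f^{α+1})_x` is injective ...
    (∀ g : (Fin n → ℂ) → ℂ, HolNear g x → MultCond f U g x β →
      MultCond f U (fun y => f y * g y) x (α + 1) → MultCond f U g x α) ∧
    -- ... and surjective.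
    (∀ g' : (Fin n → ℂ) → ℂ, HolNear g' x → MultCond f U g' x (β + 1) →
      ∃ g : (Fin n → ℂ) → ℂ, HolNear g x ∧ MultCond f U g x β ∧
        MultCond f U (fun y => g' y - f y * g y) x (α + 1)) := by
  have hα : 0 < α := hβ.trans_le hβα
  refine ⟨fun g _ h => h.mul_left hβ hf, fun g _ h => h.mul_left hα hf,
    fun g hg _ h => h.of_mul_left hα hg, fun g' _ h => ?_⟩
  obtain ⟨V, hV, hxV, hVU, hgV, hint⟩ := h.exists_integrableOn_norm_div_sq hβ hf hf0
  obtain ⟨δ, hδ, q, hsub, hq, hmul⟩ := exists_differentiableOn_mul_eq_of_integrableOn_sq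
    volume hV (hf.mono hVU) hgV hxV hne hint
  have hqx : HolNear q x := ⟨Metric.ball x δ, Metric.isOpen_ball, Metric.mem_ball_self hδ, hq⟩
  have hfq : DifferentiableOn ℂ (fun y => f y * q y) (Metric.ball x δ) :=
    (hf.mono (hsub.trans hVU)).mul hq
  refine ⟨q, hqx, MultCond.of_mul_left hβ hqx ?_,
    Metric.ball x δ, Metric.isOpen_ball, Metric.mem_ball_self hδ, hsub.trans hVU, (hgV.mono hsub).sub hfq, ?_⟩
  · obtain ⟨W, hW, hxW, hWU, -, hWint⟩ := h
    refine ⟨W ∩ Metric.ball x δ, hW.inter Metric.isOpen_ball, ⟨hxW, Metric.mem_ball_self hδ⟩,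
      Set.inter_subset_left.trans hWU, hfq.mono Set.inter_subset_right, ?_⟩
    refine (hWint.mono_set Set.inter_subset_left).congr_fun (fun y hy => ?_)
      (hW.inter Metric.isOpen_ball).measurableSet
    simp only [hmul y hy.2]
  · refine integrableOn_zero.congr_fun (fun y hy => ?_) measurableSet_ball
    simp [hmul y hy]
end
end

section
/- Let d ≥ 1 and let m₁, …, m_d be integers with m_j ≥ 2, and set f(z) = z₁^{m₁} + ⋯ + z_d^{m_d} on ℂ^d. Then for every rational α ∈ (0,1), the multiplier ideal germ 𝒥(f^α)_0 equals the monomial ideal of the local ring of holomorphic germs at 0 generated by the monomials z^ν = z₁^{ν₁}⋯z_d^{ν_d} with ν ∈ ℕ^d satisfying Σ_{j=1}^d (ν_j + 1)/m_j > α. In particular, the monomial z^ν satisfies the multiplier condition for (f, α) at 0 if and only if Σ_{j=1}^d (ν_j + 1)/m_j > α. -/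
open MeasureTheory Filter Topology

noncomputable section

variable {E : Type*} [NormedAddCommGroup E] [NormedSpace ℂ E] [MeasureSpace E]

theorem lintegral_ball_enorm_rpow_neg_lt_top {u : ℝ} (hu : u < 2) :
    ∫⁻ z in Metric.ball (0 : ℂ) 1, ‖z‖ₑ ^ (-u) < ⊤ := by
  have h : IntegrableOn (fun z : ℂ => ‖z‖ ^ (-u)) (Metric.ball 0 1) := by
    rw [integrableOn_fun_norm_addHaar volume (f := fun y : ℝ => y ^ (-u))]
    have h1 : IntegrableOn (fun y : ℝ => y ^ (1 - u)) (Set.Ioo 0 1) := by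
      rw [intervalIntegral.integrableOn_Ioo_rpow_iff one_pos]
      linarith
    refine h1.congr_fun (fun y hy => ?_) measurableSet_Ioo
    simp [Complex.finrank_real_complex, sub_eq_add_neg, Real.rpow_add hy.1]
  refine lt_of_eq_of_lt (lintegral_congr_ae ?_) h.2
  filter_upwards [ae_restrict_of_ae (Measure.ae_ne volume (0 : ℂ))] with z hz
  rw [← ofReal_norm, ENNReal.ofReal_rpow_of_pos (norm_pos_iff.2 hz),
    Real.enorm_of_nonneg (by positivity)]

theorem lintegral_ball_enorm_sub_rpow_neg_le {u : ℝ} (hu : 0 ≤ u) (ζ : ℂ) :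
    ∫⁻ z in Metric.ball (0 : ℂ) 1, ‖z - ζ‖ₑ ^ (-u) ≤
      (∫⁻ z in Metric.ball (0 : ℂ) 1, ‖z‖ₑ ^ (-u)) + volume (Metric.ball (0 : ℂ) 1) := by
  set φ : ℂ → ENNReal := (Metric.ball (0 : ℂ) 1).indicator fun z => ‖z‖ₑ ^ (-u) with hφ
  have hφm : Measurable φ := Measurable.indicator (by fun_prop) measurableSet_ball
  calc ∫⁻ z in Metric.ball (0 : ℂ) 1, ‖z - ζ‖ₑ ^ (-u)
      ≤ ∫⁻ z in Metric.ball (0 : ℂ) 1, (φ (z - ζ) + 1) := by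
        refine lintegral_mono fun z => ?_
        by_cases hz : z - ζ ∈ Metric.ball (0 : ℂ) 1
        · simp only [hφ, Set.indicator_of_mem hz]
          exact le_self_add
        · refine le_add_left ?_
          have h1 : (1 : ENNReal) ≤ ‖z - ζ‖ₑ := by
            rw [← ofReal_norm]
            exact ENNReal.one_le_ofReal.2 (by simpa using hz)
          rw [ENNReal.rpow_neg]
          exact ENNReal.inv_le_one.2 (by simpa using ENNReal.rpow_le_rpow h1 hu)
    _ = (∫⁻ z in Metric.ball (0 : ℂ) 1, φ (z - ζ)) + volume (Metric.ball (0 : ℂ) 1) := by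
        rw [lintegral_add_right _ measurable_const]
        simp
    _ ≤ (∫⁻ z, φ (z - ζ)) + volume (Metric.ball (0 : ℂ) 1) := by
        gcongr
        exact Measure.restrict_le_self
    _ = _ := by
        rw [lintegral_sub_right_eq_self φ ζ, hφ, lintegral_indicator measurableSet_ball]

theorem ENNReal.rpow_mul_rpow_neg_le {a b : ENNReal} (ha : a ≠ ⊤) (hb : b ≠ ⊤) {s t : ℝ}
    (hs : s < 0) (ht : 0 ≤ t) : a ^ s * b ^ (-t) ≤ a ^ (-(t - s)) + b ^ (-(t - s)) := by
  have key : ∀ {x y : ENNReal}, x ≠ ⊤ → x ≤ y → y ^ s ≤ x ^ s ∧ y ^ (-t) ≤ x ^ (-t) := by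
    intro x y _ hxy
    refine ⟨?_, ?_⟩
    · rw [← neg_neg s, ENNReal.rpow_neg, ENNReal.rpow_neg x]
      exact ENNReal.inv_le_inv.2 (ENNReal.rpow_le_rpow hxy (by linarith))
    · rw [ENNReal.rpow_neg, ENNReal.rpow_neg x]
      exact ENNReal.inv_le_inv.2 (ENNReal.rpow_le_rpow hxy ht)
  have key2 : ∀ {x : ENNReal}, x ≠ ⊤ → x ^ s * x ^ (-t) ≤ x ^ (-(t - s)) := by
    intro x hx
    rcases eq_or_ne x 0 with rfl | hx0
    · rw [ENNReal.zero_rpow_of_neg (y := -(t - s)) (by linarith)]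
      exact le_top
    · rw [← ENNReal.rpow_add _ _ hx0 hx]
      exact le_of_eq (by ring_nf)
  rcases le_total a b with h | h
  · refine le_add_right (le_trans ?_ (key2 ha))
    exact mul_le_mul_right (key ha h).2 _
  · refine le_add_left (le_trans ?_ (key2 hb))
    exact mul_le_mul_left (key hb h).1 _

theorem exists_lintegral_ball_rpow_mul_sub_rpow_neg_le {s t : ℝ} (ht0 : 0 ≤ t) (ht : t < 2)
    (hst : t - s < 2) :
    ∃ C : ENNReal, C < ⊤ ∧ ∀ ζ : ℂ,
      ∫⁻ z in Metric.ball (0 : ℂ) 1, ‖z‖ₑ ^ s * ‖z - ζ‖ₑ ^ (-t) ≤ C := by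
  have hvol : volume (Metric.ball (0 : ℂ) 1) < ⊤ := measure_ball_lt_top
  rcases le_or_gt 0 s with hs | hs
  · refine ⟨_, ENNReal.add_lt_top.2 ⟨lintegral_ball_enorm_rpow_neg_lt_top ht, hvol⟩,
      fun ζ => le_trans ?_ (lintegral_ball_enorm_sub_rpow_neg_le ht0 ζ)⟩
    refine setLIntegral_mono' measurableSet_ball fun z hz => ?_
    refine mul_le_of_le_one_left zero_le (ENNReal.rpow_le_one ?_ hs)
    rw [← ofReal_norm]
    exact ENNReal.ofReal_le_one.2 (mem_ball_zero_iff.1 hz).le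
  · have h2 := lintegral_ball_enorm_rpow_neg_lt_top hst
    refine ⟨_, ENNReal.add_lt_top.2 ⟨h2, ENNReal.add_lt_top.2 ⟨h2, hvol⟩⟩, fun ζ => ?_⟩
    calc ∫⁻ z in Metric.ball (0 : ℂ) 1, ‖z‖ₑ ^ s * ‖z - ζ‖ₑ ^ (-t)
        ≤ ∫⁻ z in Metric.ball (0 : ℂ) 1, (‖z‖ₑ ^ (-(t - s)) + ‖z - ζ‖ₑ ^ (-(t - s))) :=
          lintegral_mono fun z => ENNReal.rpow_mul_rpow_neg_le enorm_ne_top enorm_ne_top hs ht0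
      _ = (∫⁻ z in Metric.ball (0 : ℂ) 1, ‖z‖ₑ ^ (-(t - s))) +
          ∫⁻ z in Metric.ball (0 : ℂ) 1, ‖z - ζ‖ₑ ^ (-(t - s)) :=
          lintegral_add_left (by fun_prop) _
      _ ≤ _ := by
          gcongr
          exact lintegral_ball_enorm_sub_rpow_neg_le (by linarith) ζ

/-- `z ^ m - ζ ^ m` is bounded below by the distance from `z` to a nearest root `ω * ζ`. -/
theorem exists_rootsOfUnity_norm_sub_mul_le {m : ℕ} (hm : 0 < m) :
    ∃ k : ℝ, 0 < k ∧ ∀ z ζ : ℂ, ∃ ω ∈ Polynomial.nthRootsFinset m (1 : ℂ),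
      ‖z - ω * ζ‖ * (k * ‖z‖) ^ (m - 1) ≤ ‖z ^ m - ζ ^ m‖ := by
  classical
  have hprim := Complex.isPrimitiveRoot_exp m hm.ne'
  set R := Polynomial.nthRootsFinset m (1 : ℂ) with hR
  have hRne : R.Nonempty := ⟨1, by simp [hR, Polynomial.mem_nthRootsFinset hm]⟩
  obtain ⟨δ, hδ, hδR⟩ : ∃ δ : ℝ, 0 < δ ∧ ∀ ω ∈ R, ∀ ω' ∈ R, ω ≠ ω' → δ ≤ ‖ω - ω'‖ := by
    have : ∃ δ : ℝ, 0 < δ ∧ ∀ p ∈ R.offDiag, δ ≤ ‖p.1 - p.2‖ := by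
      rcases R.offDiag.eq_empty_or_nonempty with h | h
      · exact ⟨1, one_pos, by simp [h]⟩
      · obtain ⟨p, hp, hmin⟩ := R.offDiag.exists_min_image (fun p => ‖p.1 - p.2‖) h
        exact ⟨_, norm_pos_iff.2 (sub_ne_zero.2 (Finset.mem_offDiag.1 hp).2.2), hmin⟩
    obtain ⟨δ, h0, h⟩ := this
    exact ⟨δ, h0, fun ω hω ω' hω' hne => h (ω, ω') (Finset.mem_offDiag.2 ⟨hω, hω', hne⟩)⟩
  refine ⟨(1 + 2 / δ)⁻¹, by positivity, fun z ζ => ?_⟩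
  obtain ⟨ω, hω, hmin⟩ := R.exists_min_image (fun ω => ‖z - ω * ζ‖) hRne
  refine ⟨ω, hω, ?_⟩
  rw [hprim.pow_sub_pow_eq_prod_sub_mul z ζ hm, norm_prod, ← Finset.mul_prod_erase _ _ hω]
  gcongr
  have hcard : (R.erase ω).card = m - 1 := by
    rw [Finset.card_erase_of_mem hω, hprim.card_nthRootsFinset]
  rw [← hcard, ← Finset.prod_const]
  refine Finset.prod_le_prod (fun _ _ => by positivity) fun η hη => ?_
  obtain ⟨hne, hηR⟩ := Finset.mem_erase.1 hη
  have h1 : δ * ‖ζ‖ ≤ 2 * ‖z - η * ζ‖ :=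
    calc δ * ‖ζ‖ ≤ ‖η - ω‖ * ‖ζ‖ := by gcongr; exact hδR _ hηR _ hω hne
      _ = ‖(z - ω * ζ) - (z - η * ζ)‖ := by rw [← norm_mul]; congr 1; ring
      _ ≤ ‖z - ω * ζ‖ + ‖z - η * ζ‖ := norm_sub_le _ _
      _ ≤ 2 * ‖z - η * ζ‖ := by linarith [hmin η hηR]
  have hη1 : ‖η‖ = 1 :=
    Complex.norm_eq_one_of_pow_eq_one ((Polynomial.mem_nthRootsFinset hm _).1 hηR) hm.ne'
  have h2 : ‖z‖ ≤ ‖z - η * ζ‖ + ‖ζ‖ := by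
    have := norm_add_le (z - η * ζ) (η * ζ)
    rwa [sub_add_cancel, norm_mul, hη1, one_mul] at this
  have h3 : ‖ζ‖ ≤ 2 / δ * ‖z - η * ζ‖ := by
    rw [div_mul_eq_mul_div, le_div_iff₀ hδ]
    linarith
  rw [inv_mul_le_iff₀ (by positivity)]
  linarith

theorem exists_enorm_add_pow_rpow_neg_le {m : ℕ} (hm : 0 < m) {t : ℝ} (ht : 0 ≤ t) :
    ∃ K : ENNReal, K < ⊤ ∧ ∀ z ζ : ℂ, z ≠ 0 →
      ‖z ^ m - ζ ^ m‖ₑ ^ (-t) ≤ K * ∑ ω ∈ Polynomial.nthRootsFinset m (1 : ℂ),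
        ‖z‖ₑ ^ (-(t * (m - 1 : ℕ))) * ‖z - ω * ζ‖ₑ ^ (-t) := by
  obtain ⟨k, hk, hkz⟩ := exists_rootsOfUnity_norm_sub_mul_le hm
  have hk0 : ENNReal.ofReal k ≠ 0 := by simpa using hk
  refine ⟨ENNReal.ofReal k ^ (-(t * (m - 1 : ℕ))),
    (ENNReal.rpow_ne_top_of_ne_zero hk0 ENNReal.ofReal_ne_top).lt_top, fun z ζ hz => ?_⟩
  obtain ⟨ω, hω, h⟩ := hkz z ζ
  have hz0 : ‖z‖ₑ ≠ 0 := by simpa using hz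
  have h' : ‖z - ω * ζ‖ₑ * (ENNReal.ofReal k * ‖z‖ₑ) ^ (m - 1) ≤ ‖z ^ m - ζ ^ m‖ₑ := by
    rw [← ofReal_norm, ← ofReal_norm, ← ofReal_norm, ← ENNReal.ofReal_mul hk.le,
      ← ENNReal.ofReal_pow (by positivity), ← ENNReal.ofReal_mul (by positivity)]
    exact ENNReal.ofReal_le_ofReal h
  refine le_trans ?_ (mul_le_mul_right (Finset.single_le_sum
    (f := fun ω => ‖z‖ₑ ^ (-(t * (m - 1 : ℕ))) * ‖z - ω * ζ‖ₑ ^ (-t))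
    (fun _ _ => zero_le) hω) _)
  refine le_trans (b := (‖z - ω * ζ‖ₑ * (ENNReal.ofReal k * ‖z‖ₑ) ^ (m - 1)) ^ (-t)) ?_ ?_
  · rw [ENNReal.rpow_neg, ENNReal.rpow_neg]
    exact ENNReal.inv_le_inv.2 (ENNReal.rpow_le_rpow h' ht)
  · have hp0 : (ENNReal.ofReal k * ‖z‖ₑ) ^ (m - 1) ≠ 0 := pow_ne_zero _ (mul_ne_zero hk0 hz0)
    have hpt : (ENNReal.ofReal k * ‖z‖ₑ) ^ (m - 1) ≠ ⊤ :=
      ENNReal.pow_ne_top (ENNReal.mul_ne_top ENNReal.ofReal_ne_top enorm_ne_top)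
    rw [ENNReal.rpow_neg, ENNReal.mul_rpow_of_nonneg _ _ ht,
      ENNReal.mul_inv (Or.inr (ENNReal.rpow_ne_top_of_nonneg ht hpt))
        (Or.inr (by simp [ENNReal.rpow_eq_zero_iff, hp0, hpt])),
      ← ENNReal.rpow_neg, ← ENNReal.rpow_natCast, ← ENNReal.rpow_mul, ← ENNReal.rpow_neg,
      mul_comm ((m - 1 : ℕ) : ℝ) t, ENNReal.mul_rpow_of_ne_zero hk0 hz0]
    exact le_of_eq (by ring)

theorem exists_lintegral_ball_rpow_mul_add_pow_rpow_neg_le {m : ℕ} (hm : 0 < m) {p t : ℝ}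
    (ht0 : 0 ≤ t) (ht : t < 2) (hp : t * m < p + 2) :
    ∃ C : ENNReal, C < ⊤ ∧ ∀ c : ℂ,
      ∫⁻ z in Metric.ball (0 : ℂ) 1, ‖z‖ₑ ^ p * ‖c + z ^ m‖ₑ ^ (-t) ≤ C := by
  obtain ⟨K, hK, hKz⟩ := exists_enorm_add_pow_rpow_neg_le hm ht0
  have hm1 : ((m - 1 : ℕ) : ℝ) = m - 1 := by push_cast [Nat.cast_sub hm]; ring
  obtain ⟨C, hC, hCz⟩ := exists_lintegral_ball_rpow_mul_sub_rpow_neg_le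
    (s := p - t * (m - 1 : ℕ)) ht0 ht (by rw [hm1]; linarith)
  set R := Polynomial.nthRootsFinset m (1 : ℂ)
  refine ⟨K * ∑ ω ∈ R, C, ENNReal.mul_lt_top hK (by simp [ENNReal.mul_lt_top, hC]), fun c => ?_⟩
  obtain ⟨ζ, hζ⟩ := IsAlgClosed.exists_pow_nat_eq (-c) hm
  calc ∫⁻ z in Metric.ball (0 : ℂ) 1, ‖z‖ₑ ^ p * ‖c + z ^ m‖ₑ ^ (-t)
      ≤ ∫⁻ z in Metric.ball (0 : ℂ) 1,
          K * ∑ ω ∈ R, ‖z‖ₑ ^ (p - t * (m - 1 : ℕ)) * ‖z - ω * ζ‖ₑ ^ (-t) := by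
        refine lintegral_mono_ae ?_
        filter_upwards [ae_restrict_of_ae (Measure.ae_ne volume (0 : ℂ))] with z hz
        have hz0 : ‖z‖ₑ ≠ 0 := by simpa using hz
        have := hKz z ζ hz
        rw [hζ, sub_neg_eq_add, add_comm] at this
        refine (mul_le_mul_right this _).trans (le_of_eq ?_)
        rw [mul_left_comm, Finset.mul_sum]
        congr 1
        refine Finset.sum_congr rfl fun ω _ => ?_
        rw [← mul_assoc, ← ENNReal.rpow_add _ _ hz0 enorm_ne_top, ← sub_eq_add_neg]
    _ = K * ∑ ω ∈ R, ∫⁻ z in Metric.ball (0 : ℂ) 1,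
          ‖z‖ₑ ^ (p - t * (m - 1 : ℕ)) * ‖z - ω * ζ‖ₑ ^ (-t) := by
        rw [lintegral_const_mul' _ _ hK.ne, lintegral_finsetSum _ (fun _ _ => by fun_prop)]
    _ ≤ _ := by
        gcongr
        exact hCz _

theorem ENNReal.rpow_mul_rpow_neg_le_rpow_neg_sub {x : ENNReal} (hx : x ≠ ⊤) {b t : ℝ}
    (hb : 0 ≤ b) (hbt : b ≤ t) : x ^ b * x ^ (-t) ≤ x ^ (-(t - b)) := by
  rcases eq_or_ne x 0 with rfl | hx0
  · rcases hb.eq_or_lt with rfl | hb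
    · simp
    · simp [ENNReal.zero_rpow_of_pos hb]
  · rw [← ENNReal.rpow_add _ _ hx0 hx]
    exact le_of_eq (by ring_nf)

theorem ENNReal.add_rpow_le_two_rpow_mul (x y : ENNReal) {b : ℝ} (hb : 0 ≤ b) :
    (x + y) ^ b ≤ 2 ^ b * (x ^ b + y ^ b) := by
  rcases le_total x y with h | h
  · calc (x + y) ^ b ≤ (2 * y) ^ b := by
          refine ENNReal.rpow_le_rpow ?_ hb
          rw [two_mul]
          gcongr
      _ = 2 ^ b * y ^ b := ENNReal.mul_rpow_of_nonneg _ _ hb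
      _ ≤ _ := by
          gcongr
          exact le_add_self
  · calc (x + y) ^ b ≤ (2 * x) ^ b := by
          refine ENNReal.rpow_le_rpow ?_ hb
          rw [two_mul]
          gcongr
      _ = 2 ^ b * x ^ b := ENNReal.mul_rpow_of_nonneg _ _ hb
      _ ≤ _ := by
          gcongr
          exact le_self_add

theorem exists_lintegral_ball_le_mul_rpow_neg {m : ℕ} (hm : 0 < m) {p t b : ℝ}
    (hb : 0 ≤ b) (hbt : b ≤ t) (ht : t < 2) (hp : (t - b) * m < p + 2) :
    ∃ C : ENNReal, C < ⊤ ∧ ∀ c : ℂ,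
      ∫⁻ z in Metric.ball (0 : ℂ) 1, ‖z‖ₑ ^ p * ‖c + z ^ m‖ₑ ^ (-t) ≤ C * ‖c‖ₑ ^ (-b) := by
  obtain ⟨C₁, hC₁, h₁⟩ := exists_lintegral_ball_rpow_mul_add_pow_rpow_neg_le (p := p) hm
    (sub_nonneg.2 hbt) (by linarith) hp
  obtain ⟨C₂, hC₂, h₂⟩ := exists_lintegral_ball_rpow_mul_add_pow_rpow_neg_le (p := p + m * b) hm
    (hb.trans hbt) ht (by linarith)
  have h2b : (2 : ENNReal) ^ b < ⊤ := (ENNReal.rpow_ne_top_of_nonneg hb ENNReal.ofNat_ne_top).lt_top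
  have hC : (2 : ENNReal) ^ b * (C₁ + C₂) + 1 < ⊤ :=
    ENNReal.add_lt_top.2
      ⟨ENNReal.mul_lt_top h2b (ENNReal.add_lt_top.2 ⟨hC₁, hC₂⟩), ENNReal.one_lt_top⟩
  have key : ∀ c : ℂ, ‖c‖ₑ ^ b *
      ∫⁻ z in Metric.ball (0 : ℂ) 1, ‖z‖ₑ ^ p * ‖c + z ^ m‖ₑ ^ (-t) ≤ 2 ^ b * (C₁ + C₂) := by
    intro c
    rw [← lintegral_const_mul' _ _ (ENNReal.rpow_ne_top_of_nonneg hb enorm_ne_top)]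
    calc ∫⁻ z in Metric.ball (0 : ℂ) 1, ‖c‖ₑ ^ b * (‖z‖ₑ ^ p * ‖c + z ^ m‖ₑ ^ (-t))
        ≤ ∫⁻ z in Metric.ball (0 : ℂ) 1, 2 ^ b * (‖z‖ₑ ^ p * ‖c + z ^ m‖ₑ ^ (-(t - b)) +
            ‖z‖ₑ ^ (p + m * b) * ‖c + z ^ m‖ₑ ^ (-t)) := by
          refine lintegral_mono_ae ?_
          filter_upwards [ae_restrict_of_ae (Measure.ae_ne volume (0 : ℂ))] with z hz
          have hz0 : ‖z‖ₑ ≠ 0 := by simpa using hz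
          have h3 : ‖c‖ₑ ≤ ‖c + z ^ m‖ₑ + ‖z‖ₑ ^ m := by
            have := enorm_sub_le (a := c + z ^ m) (b := z ^ m)
            rwa [add_sub_cancel_right, enorm_pow] at this
          calc ‖c‖ₑ ^ b * (‖z‖ₑ ^ p * ‖c + z ^ m‖ₑ ^ (-t))
              ≤ (2 ^ b * (‖c + z ^ m‖ₑ ^ b + (‖z‖ₑ ^ m) ^ b)) *
                  (‖z‖ₑ ^ p * ‖c + z ^ m‖ₑ ^ (-t)) :=
                mul_le_mul_left ((ENNReal.rpow_le_rpow h3 hb).trans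
                  (ENNReal.add_rpow_le_two_rpow_mul _ _ hb)) _
            _ = 2 ^ b * (‖z‖ₑ ^ p * (‖c + z ^ m‖ₑ ^ b * ‖c + z ^ m‖ₑ ^ (-t)) +
                  (‖z‖ₑ ^ p * (‖z‖ₑ ^ m) ^ b) * ‖c + z ^ m‖ₑ ^ (-t)) := by ring
            _ ≤ _ := by
                rw [← ENNReal.rpow_natCast ‖z‖ₑ m, ← ENNReal.rpow_mul,
                  ← ENNReal.rpow_add _ _ hz0 enorm_ne_top]
                gcongr
                exact ENNReal.rpow_mul_rpow_neg_le_rpow_neg_sub enorm_ne_top hb hbt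
      _ = 2 ^ b * ((∫⁻ z in Metric.ball (0 : ℂ) 1, ‖z‖ₑ ^ p * ‖c + z ^ m‖ₑ ^ (-(t - b))) +
            ∫⁻ z in Metric.ball (0 : ℂ) 1, ‖z‖ₑ ^ (p + m * b) * ‖c + z ^ m‖ₑ ^ (-t)) := by
          rw [lintegral_const_mul' _ _ h2b.ne, lintegral_add_left (by fun_prop)]
      _ ≤ _ := by
          gcongr
          exacts [h₁ c, h₂ c]
  refine ⟨_, hC, fun c => ?_⟩
  rcases hb.eq_or_lt with rfl | hb'
  · have := key c
    simp only [ENNReal.rpow_zero, one_mul, neg_zero, mul_one] at this ⊢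
    exact this.trans le_self_add
  rcases eq_or_ne c 0 with rfl | hc
  · rw [enorm_zero, ENNReal.zero_rpow_of_neg (by linarith), ENNReal.mul_top (by simp)]
    exact le_top
  · have hc0 : ‖c‖ₑ ≠ 0 := by simpa using hc
    have h0 : ‖c‖ₑ ^ b ≠ 0 := by simp [ENNReal.rpow_eq_zero_iff, hc]
    have h0' : ‖c‖ₑ ^ b ≠ ⊤ := ENNReal.rpow_ne_top_of_nonneg hb enorm_ne_top
    rw [ENNReal.rpow_neg, ← div_eq_mul_inv, ENNReal.le_div_iff_mul_le (Or.inl h0) (Or.inl h0'),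
      mul_comm]
    exact (key c).trans le_self_add

theorem exists_lintegral_pi_ball_le (d : ℕ) (m : Fin d → ℕ) (hm : ∀ j, 0 < m j)
    (p : Fin d → ℝ) (hp : ∀ j, -2 < p j) (t : ℝ) (ht0 : 0 ≤ t) (ht : t < 2)
    (hts : t = 0 ∨ t < ∑ j, (p j + 2) / m j) :
    ∃ C : ENNReal, C < ⊤ ∧ ∀ c : ℂ,
      ∫⁻ z, (∏ j, ‖z j‖ₑ ^ p j) * ‖c + ∑ j, z j ^ m j‖ₑ ^ (-t)
        ∂(Measure.pi fun _ : Fin d => volume.restrict (Metric.ball (0 : ℂ) 1)) ≤ C := by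
  induction d generalizing t with
  | zero =>
    have ht : t = 0 := by
      rcases hts with h | h
      · exact h
      · simp at h; linarith
    subst ht
    refine ⟨1, by simp, fun c => ?_⟩
    simp
  | succ d ih =>
    have hm0 : (0 : ℝ) < m 0 := by exact_mod_cast hm 0
    have hmj : ∀ j, (0 : ℝ) < m j := fun j => by exact_mod_cast hm j
    set S := ∑ j : Fin d, (p j.succ + 2) / m j.succ with hS
    have hS0 : 0 ≤ S :=
      Finset.sum_nonneg fun j _ => div_nonneg (by linarith [hp j.succ]) (hmj _).le
    have ha : 0 < (p 0 + 2) / m 0 := div_pos (by linarith [hp 0]) hm0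
    obtain ⟨b, hb0, hbt, hbS, hba⟩ :
        ∃ b : ℝ, 0 ≤ b ∧ b ≤ t ∧ (b = 0 ∨ b < S) ∧ t - b < (p 0 + 2) / m 0 := by
      rcases lt_or_ge t ((p 0 + 2) / m 0) with h | h
      · exact ⟨0, le_rfl, ht0, Or.inl rfl, by linarith⟩
      · rw [Fin.sum_univ_succ, ← hS] at hts
        have hts : t < (p 0 + 2) / m 0 + S := by
          rcases hts with h | h
          · linarith
          · exact h
        have h1 : t - (p 0 + 2) / m 0 < min S t := lt_min (by linarith) (by linarith)
        obtain ⟨b, hb1, hb2⟩ := exists_between h1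
        exact ⟨b, by linarith, (hb2.trans_le (min_le_right _ _)).le,
          Or.inr (hb2.trans_le (min_le_left _ _)), by linarith⟩
    obtain ⟨C₁, hC₁, h₁⟩ := exists_lintegral_ball_le_mul_rpow_neg (p := p 0) (hm 0) hb0 hbt ht
      ((lt_div_iff₀ hm0).1 hba)
    obtain ⟨C₂, hC₂, h₂⟩ := ih (fun j => m j.succ) (fun j => hm _) (fun j => p j.succ)
      (fun j => hp _) b hb0 (hbt.trans_lt ht) hbS
    refine ⟨C₁ * C₂, ENNReal.mul_lt_top hC₁ hC₂, fun c => ?_⟩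
    set μ : Measure ℂ := volume.restrict (Metric.ball (0 : ℂ) 1) with hμ
    let G : ℂ × (Fin d → ℂ) → ENNReal := fun q =>
      (∏ j : Fin d, ‖q.2 j‖ₑ ^ p j.succ) *
        (‖q.1‖ₑ ^ p 0 * ‖(c + ∑ j : Fin d, q.2 j ^ m j.succ) + q.1 ^ m 0‖ₑ ^ (-t))
    have hG : Measurable G := by fun_prop
    have hmp := measurePreserving_piFinSuccAbove (fun _ : Fin (d + 1) => μ) 0
    calc ∫⁻ z, (∏ j, ‖z j‖ₑ ^ p j) * ‖c + ∑ j, z j ^ m j‖ₑ ^ (-t) ∂(Measure.pi fun _ => μ)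
        = ∫⁻ z, G (MeasurableEquiv.piFinSuccAbove (fun _ => ℂ) 0 z) ∂(Measure.pi fun _ => μ) := by
          refine lintegral_congr fun z => ?_
          simp only [G, Fin.prod_univ_succ, Fin.sum_univ_succ,
            MeasurableEquiv.piFinSuccAbove_apply, Fin.insertNthEquiv_symm_apply, Fin.removeNth,
            Fin.succAbove_zero]
          rw [show c + (z 0 ^ m 0 + ∑ i : Fin d, z i.succ ^ m i.succ) =
            c + ∑ i : Fin d, z i.succ ^ m i.succ + z 0 ^ m 0 by ring]
          ring
      _ = ∫⁻ q, G q ∂(μ.prod (Measure.pi fun _ : Fin d => μ)) :=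
          hmp.lintegral_comp_emb (MeasurableEquiv.measurableEmbedding _) G
      _ = ∫⁻ y, ∫⁻ x, G (x, y) ∂μ ∂(Measure.pi fun _ : Fin d => μ) :=
          lintegral_prod_symm' G hG
      _ ≤ ∫⁻ y, C₁ * ((∏ j : Fin d, ‖y j‖ₑ ^ p j.succ) *
            ‖c + ∑ j : Fin d, y j ^ m j.succ‖ₑ ^ (-b)) ∂(Measure.pi fun _ : Fin d => μ) := by
          refine lintegral_mono fun y => ?_
          simp only [G]
          rw [lintegral_const_mul _ (by fun_prop), mul_left_comm]
          gcongr
          exact h₁ _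
      _ = C₁ * ∫⁻ y, (∏ j : Fin d, ‖y j‖ₑ ^ p j.succ) *
            ‖c + ∑ j : Fin d, y j ^ m j.succ‖ₑ ^ (-b) ∂(Measure.pi fun _ : Fin d => μ) :=
          lintegral_const_mul' _ _ hC₁.ne
      _ ≤ C₁ * C₂ := by
          gcongr
          exact h₂ c

section Closure

variable {d : ℕ} {f g h : (Fin d → ℂ) → ℂ} {α : ℝ}

theorem HolNear.of_differentiable (hg : Differentiable ℂ g) : HolNear g 0 :=
  ⟨Set.univ, isOpen_univ, trivial, hg.differentiableOn⟩

theorem differentiable_monomial (ν : Fin d → ℕ) :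
    Differentiable ℂ fun z : Fin d → ℂ => ∏ j, z j ^ ν j := by
  intro z
  have h : ∀ j ∈ (Finset.univ : Finset (Fin d)), HasFDerivAt (fun z : Fin d → ℂ => z j ^ ν j)
      (fderiv ℂ (fun z : Fin d → ℂ => z j ^ ν j) z) z := fun j _ =>
    (by fun_prop : DifferentiableAt ℂ (fun z : Fin d → ℂ => z j ^ ν j) z).hasFDerivAt
  exact (HasFDerivAt.finsetProd h).differentiableAt

theorem HolNear.add (hg : HolNear g 0) (hh : HolNear h 0) : HolNear (fun z => g z + h z) 0 := by
  obtain ⟨V, hV, h0, hd⟩ := hg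
  obtain ⟨W, hW, h0', hd'⟩ := hh
  exact ⟨V ∩ W, hV.inter hW, ⟨h0, h0'⟩,
    (hd.mono Set.inter_subset_left).add (hd'.mono Set.inter_subset_right)⟩

theorem HolNear.mul (hg : HolNear g 0) (hh : HolNear h 0) : HolNear (fun z => g z * h z) 0 := by
  obtain ⟨V, hV, h0, hd⟩ := hg
  obtain ⟨W, hW, h0', hd'⟩ := hh
  exact ⟨V ∩ W, hV.inter hW, ⟨h0, h0'⟩,
    (hd.mono Set.inter_subset_left).mul (hd'.mono Set.inter_subset_right)⟩

theorem HolNear.comp_differentiable {φ : (Fin d → ℂ) → Fin d → ℂ} (hg : HolNear g 0)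
    (hφ : Differentiable ℂ φ) (h0 : φ 0 = 0) : HolNear (fun z => g (φ z)) 0 := by
  obtain ⟨V, hV, hV0, hd⟩ := hg
  exact ⟨φ ⁻¹' V, hV.preimage hφ.continuous, by simpa [h0] using hV0,
    hd.comp hφ.differentiableOn (Set.mapsTo_preimage _ _)⟩

theorem MultCond.holNear {U : Set (Fin d → ℂ)} (hg : MultCond f U g 0 α) : HolNear g 0 := by
  obtain ⟨V, hV, h0, -, hd, -⟩ := hg
  exact ⟨V, hV, h0, hd⟩

theorem MultCond.of_le (hf : Measurable f) (hg : HolNear g 0) {V : Set (Fin d → ℂ)}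
    (hV : IsOpen V) (hV0 : 0 ∈ V) {F : (Fin d → ℂ) → ℝ} (hF : IntegrableOn F V)
    (hle : ∀ z ∈ V, ‖g z‖ ^ 2 / ‖f z‖ ^ (2 * α) ≤ F z) : MultCond f Set.univ g 0 α := by
  obtain ⟨W, hW, hW0, hd⟩ := hg
  refine ⟨V ∩ W, hV.inter hW, ⟨hV0, hW0⟩, Set.subset_univ _, hd.mono Set.inter_subset_right, ?_⟩
  have hm : MeasurableSet (V ∩ W) := (hV.inter hW).measurableSet
  refine Integrable.mono' (hF.mono_set Set.inter_subset_left) ?_ ?_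
  · have h1 : AEMeasurable g (volume.restrict (V ∩ W)) :=
      (hd.mono Set.inter_subset_right).continuousOn.aemeasurable hm
    exact ((h1.norm.pow_const 2).div (by fun_prop)).aestronglyMeasurable
  · filter_upwards [ae_restrict_mem hm] with z hz
    rw [Real.norm_of_nonneg (by positivity)]
    exact hle z hz.1

theorem MultCond.congr (hf : Measurable f) (hg : MultCond f Set.univ g 0 α)
    (hgh : h =ᶠ[𝓝 0] g) : MultCond f Set.univ h 0 α := by
  obtain ⟨V, hV, hV0, -, hd, hi⟩ := hg
  obtain ⟨W, hWs, hW, hW0⟩ := eventually_nhds_iff.1 hgh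
  refine MultCond.of_le hf ⟨V ∩ W, hV.inter hW, ⟨hV0, hW0⟩, ?_⟩ (hV.inter hW) ⟨hV0, hW0⟩
    (hi.mono_set Set.inter_subset_left) fun z hz => by rw [hWs z hz.2]
  exact (hd.mono Set.inter_subset_left).congr fun z hz => hWs z hz.2

theorem MultCond.add (hf : Measurable f) (hg : MultCond f Set.univ g 0 α)
    (hh : MultCond f Set.univ h 0 α) : MultCond f Set.univ (fun z => g z + h z) 0 α := by
  have hol := hg.holNear.add hh.holNear
  obtain ⟨V, hV, hV0, -, -, hi⟩ := hg
  obtain ⟨W, hW, hW0, -, -, hi'⟩ := hh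
  refine MultCond.of_le hf hol (hV.inter hW) ⟨hV0, hW0⟩
    (((hi.mono_set Set.inter_subset_left).add (hi'.mono_set Set.inter_subset_right)).const_mul 2)
    fun z _ => ?_
  have h1 : ‖g z + h z‖ ^ 2 ≤ 2 * (‖g z‖ ^ 2 + ‖h z‖ ^ 2) := by
    have := norm_add_le (g z) (h z)
    nlinarith [sq_nonneg (‖g z‖ - ‖h z‖), norm_nonneg (g z + h z)]
  calc ‖g z + h z‖ ^ 2 / ‖f z‖ ^ (2 * α)
      ≤ 2 * (‖g z‖ ^ 2 + ‖h z‖ ^ 2) / ‖f z‖ ^ (2 * α) := by gcongr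
    _ = 2 * (‖g z‖ ^ 2 / ‖f z‖ ^ (2 * α) + ‖h z‖ ^ 2 / ‖f z‖ ^ (2 * α)) := by ring

theorem MultCond.mul_left_s10 (hf : Measurable f) (hh : HolNear h 0)
    (hg : MultCond f Set.univ g 0 α) : MultCond f Set.univ (fun z => h z * g z) 0 α := by
  have hol := hh.mul hg.holNear
  obtain ⟨V, hV, hV0, -, -, hi⟩ := hg
  obtain ⟨W, hW, hW0, hd⟩ := hh
  have hc : ContinuousAt h 0 := (hd.continuousOn).continuousAt (hW.mem_nhds hW0)
  have hb : ∀ᶠ z in 𝓝 0, ‖h z‖ < ‖h 0‖ + 1 :=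
    hc.norm.eventually_lt continuousAt_const (by linarith)
  obtain ⟨T, hTs, hT, hT0⟩ := eventually_nhds_iff.1 hb
  refine MultCond.of_le hf hol (hV.inter hT) ⟨hV0, hT0⟩
    ((hi.mono_set Set.inter_subset_left).const_mul ((‖h 0‖ + 1) ^ 2)) fun z hz => ?_
  rw [norm_mul, mul_pow, mul_div_assoc]
  gcongr
  exact (hTs z hz.2).le

theorem MultCond.zero (hf : Measurable f) : MultCond f Set.univ (fun _ => 0) 0 α :=
  MultCond.of_le hf (HolNear.of_differentiable (differentiable_const _)) isOpen_univ trivial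
    (F := fun _ => 0) (by simp) (by simp)

theorem MultCond.sum (hf : Measurable f) {ι : Type*} (s : Finset ι) {G : ι → (Fin d → ℂ) → ℂ}
    (hG : ∀ i ∈ s, MultCond f Set.univ (G i) 0 α) :
    MultCond f Set.univ (fun z => ∑ i ∈ s, G i z) 0 α := by
  classical
  induction s using Finset.induction_on with
  | empty => simpa using MultCond.zero hf
  | insert i s hi ih =>
    simp only [Finset.sum_insert hi]
    exact (hG i (by simp)).add hf (ih fun j hj => hG j (by simp [hj]))

/-- The multiplier condition is transported by measure preserving coordinate changes
fixing `f`. -/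
theorem MultCond.comp_measurePreserving {φ : (Fin d → ℂ) → Fin d → ℂ} (hφ : Differentiable ℂ φ)
    (h0 : φ 0 = 0) (hmp : MeasurePreserving φ) (hfφ : ∀ z, f (φ z) = f z)
    (hg : MultCond f Set.univ g 0 α) (he : MeasurableEmbedding φ) :
    MultCond f Set.univ (fun z => g (φ z)) 0 α := by
  obtain ⟨V, hV, hV0, -, hd, hi⟩ := hg
  refine ⟨φ ⁻¹' V, hV.preimage hφ.continuous, by simpa [h0] using hV0, Set.subset_univ _,
    hd.comp hφ.differentiableOn (Set.mapsTo_preimage _ _), ?_⟩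
  have := (hmp.integrableOn_comp_preimage he).2 hi
  refine this.congr_fun (fun z _ => ?_) (hV.preimage hφ.continuous).measurableSet
  simp [hfφ]

theorem multCond_monomial {m : Fin d → ℕ} (hm : ∀ j, 0 < m j) (hα0 : 0 < α) (hα1 : α < 1)
    {ν : Fin d → ℕ} (hν : α < ∑ j, ((ν j : ℝ) + 1) / m j) :
    MultCond (fun z : Fin d → ℂ => ∑ j, z j ^ m j) Set.univ (fun z => ∏ j, z j ^ ν j) 0 α := by
  obtain ⟨C, hC, hCz⟩ := exists_lintegral_pi_ball_le d m hm (fun j => 2 * ν j)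
    (fun j => by have : (0 : ℝ) ≤ ν j := by positivity
                 linarith) (2 * α) (by linarith) (by linarith) (Or.inr (by
      rw [show ∑ j, (2 * (ν j : ℝ) + 2) / m j = 2 * ∑ j, ((ν j : ℝ) + 1) / m j by
        rw [Finset.mul_sum]; exact Finset.sum_congr rfl fun j _ => by ring]
      linarith))
  set V : Set (Fin d → ℂ) := Set.univ.pi fun _ => Metric.ball (0 : ℂ) 1 with hV
  refine ⟨V, isOpen_set_pi Set.finite_univ fun _ _ => Metric.isOpen_ball, by simp [hV],
    Set.subset_univ _, (differentiable_monomial ν).differentiableOn, Measurable.aestronglyMeasurable (by fun_prop), ?_⟩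
  refine lt_of_le_of_lt ?_ (lt_of_le_of_lt (hCz 0) hC)
  rw [hV, volume_pi, Measure.restrict_pi_pi]
  refine lintegral_mono fun z => ?_
  simp only [zero_add]
  rw [Real.enorm_of_nonneg (by positivity)]
  have h1 : ∏ j, ‖z j‖ₑ ^ (2 * (ν j : ℝ)) = ENNReal.ofReal (‖∏ j, z j ^ ν j‖ ^ 2) := by
    rw [norm_prod, ← Finset.prod_pow, ENNReal.ofReal_prod_of_nonneg (fun _ _ => by positivity)]
    refine Finset.prod_congr rfl fun j _ => ?_
    rw [← ofReal_norm, norm_pow, ← pow_mul, ENNReal.ofReal_pow (norm_nonneg _),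
      ← ENNReal.rpow_natCast]
    congr 1
    push_cast
    ring
  rw [h1, div_eq_mul_inv, ENNReal.ofReal_mul (by positivity)]
  gcongr
  rcases eq_or_ne (∑ j, z j ^ m j) 0 with h2 | h2
  · simp [h2, Real.zero_rpow (by linarith : (2 * α) ≠ 0)]
  · have h3 := norm_pos_iff.2 h2
    rw [← Real.rpow_neg h3.le, ← ofReal_norm, ENNReal.ofReal_rpow_of_pos h3]

end Closure

section ParametricIntegral

variable {d : ℕ} {β : Type*} [MeasurableSpace β] {μ : Measure β} {U : Set (Fin d → ℂ)}
  {F : (Fin d → ℂ) → β → ℂ}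

theorem aestronglyMeasurable_fderiv_param (hU : IsOpen U)
    (hFm : ∀ x ∈ U, AEStronglyMeasurable (F x) μ)
    (hFd : ∀ a, DifferentiableOn ℂ (fun x => F x a) U) {x : Fin d → ℂ} (hx : x ∈ U) :
    AEStronglyMeasurable (fun a => fderiv ℂ (fun y => F y a) x) μ := by
  have hcomp (i : Fin d) :
      AEStronglyMeasurable (fun a => fderiv ℂ (fun y => F y a) x (Pi.single i 1)) μ := by
    obtain ⟨ε, hε, hεU⟩ := Metric.isOpen_iff.1 hU x hx
    set c : ℕ → ℂ := fun n => ((ε / 2 / (n + 1) : ℝ) : ℂ) with hc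
    have hc_norm (n : ℕ) : ‖c n‖ < ε := by
      rw [hc, Complex.norm_real, Real.norm_of_nonneg (by positivity)]
      calc ε / 2 / (n + 1) ≤ ε / 2 := div_le_self (by positivity) (by simp)
        _ < ε := by linarith
    have hc0 (n : ℕ) : c n ≠ 0 :=
      Complex.ofReal_ne_zero.2 (by positivity)
    have hc_lim : Tendsto c atTop (𝓝 0) := by
      have : Tendsto (fun n : ℕ => ε / 2 / ((n : ℝ) + 1)) atTop (𝓝 0) := by
        simpa [div_eq_mul_inv] using
          (tendsto_one_div_add_atTop_nhds_zero_nat (𝕜 := ℝ)).const_mul (ε / 2)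
      simpa only [Complex.ofReal_zero, Function.comp_def] using
        (Complex.continuous_ofReal.tendsto 0).comp this
    have hmem (n : ℕ) : x + c n • Pi.single i (1 : ℂ) ∈ U := by
      refine hεU ?_
      rw [mem_ball_iff_norm, add_sub_cancel_left, norm_smul, Pi.norm_single]
      simpa using hc_norm n
    clear_value c
    have hm (n : ℕ) : AEStronglyMeasurable
        (fun a => (c n)⁻¹ • (F (x + c n • Pi.single i (1 : ℂ)) a - F x a)) μ := by
      have h1 := hFm _ (hmem n)
      have h2 := hFm x hx
      fun_prop
    refine aestronglyMeasurable_of_tendsto_ae atTop hm (Eventually.of_forall fun a => ?_)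
    have h1 := ((hFd a).differentiableAt (hU.mem_nhds hx)).hasFDerivAt.hasLineDerivAt
      (Pi.single i (1 : ℂ))
    have h2 := hasDerivAt_iff_tendsto_slope_zero.1 h1
    have h3 := h2.comp (tendsto_nhdsWithin_iff.2 ⟨hc_lim, Eventually.of_forall hc0⟩)
    simpa [Function.comp_def] using h3
  have : (fun a => fderiv ℂ (fun y => F y a) x) = fun a => ∑ i,
      fderiv ℂ (fun y => F y a) x (Pi.single i 1) • ContinuousLinearMap.proj (R := ℂ)
        (φ := fun _ : Fin d => ℂ) i := by
    funext a
    ext v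
    conv_lhs => rw [← Finset.univ_sum_single v, map_sum]
    simp only [sum_apply, smul_apply,
      ContinuousLinearMap.proj_apply, smul_eq_mul]
    refine Finset.sum_congr rfl fun i _ => ?_
    rw [show (Pi.single i (v i) : Fin d → ℂ) = v i • Pi.single i 1 by
      rw [← Pi.single_smul]; simp, map_smul, smul_eq_mul, mul_comm]
  rw [this]
  fun_prop

/-- The integral of a uniformly bounded family of holomorphic functions is holomorphic. -/
theorem differentiableOn_integral_of_bounded [IsFiniteMeasure μ] (hU : IsOpen U)
    (hFm : ∀ x ∈ U, AEStronglyMeasurable (F x) μ)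
    (hFd : ∀ a, DifferentiableOn ℂ (fun x => F x a) U) {C : ℝ}
    (hC : ∀ a, ∀ x ∈ U, ‖F x a‖ ≤ C) : DifferentiableOn ℂ (fun x => ∫ a, F x a ∂μ) U := by
  intro x hx
  obtain ⟨ε, hε, hεU⟩ := Metric.isOpen_iff.1 hU x hx
  refine (hasFDerivAt_integral_of_dominated_loc_of_lip'
    (F' := fun a => fderiv ℂ (fun y => F y a) x) (bound := fun _ => 2 * C / ε)
    (Metric.ball_mem_nhds x hε) (fun y hy => hFm y (hεU hy)) ?_
    (aestronglyMeasurable_fderiv_param hU hFm hFd hx) ?_ (integrable_const _)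
    ?_).2.differentiableAt.differentiableWithinAt
  · exact Integrable.of_bound (hFm x hx) C (Eventually.of_forall fun a => hC a x hx)
  · refine Eventually.of_forall fun a y hy => ?_
    have := Complex.dist_le_div_mul_dist_of_mapsTo_ball (R₂ := 2 * C) ((hFd a).mono hεU)
      (fun y hy => ?_) hy
    · simpa [dist_eq_norm] using this
    · rw [mem_closedBall_iff_norm]
      linarith [norm_sub_le (F y a) (F x a), hC a y (hεU hy), hC a x hx]
  · exact Eventually.of_forall fun a =>
      ((hFd a).differentiableAt (hU.mem_nhds hx)).hasFDerivAt

end ParametricIntegral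

section Hadamard

variable {d : ℕ} {g : (Fin d → ℂ) → ℂ}

theorem HolNear.exists_eq_update_add_mul (hg : HolNear g 0) (j : Fin d) :
    ∃ q : (Fin d → ℂ) → ℂ, HolNear q 0 ∧
      ∀ᶠ z in 𝓝 0, g z = g (Function.update z j 0) + z j * q z := by
  obtain ⟨W, hW, hW0, hd⟩ := hg
  obtain ⟨ε, hε, hεW⟩ := Metric.isOpen_iff.1 hW 0 hW0
  have hgc : ContinuousAt g 0 := hd.continuousOn.continuousAt (hW.mem_nhds hW0)
  obtain ⟨δ, hδ, hδb⟩ := Metric.eventually_nhds_iff_ball.1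
    (hgc.norm.eventually_lt (continuousAt_const (y := ‖g 0‖ + 1)) (by linarith))
  obtain ⟨r, hr, hrε, hrδ⟩ : ∃ r : ℝ, 0 < r ∧ r < ε ∧ r < δ :=
    ⟨min ε δ / 2, by positivity, by linarith [min_le_left ε δ, lt_min hε hδ],
      by linarith [min_le_right ε δ, lt_min hε hδ]⟩
  set U : Set (Fin d → ℂ) := Metric.ball 0 (r / 2) with hU
  have hup {z : Fin d → ℂ} (hz : z ∈ U) {w : ℂ} (hw : ‖w‖ ≤ r) :
      ‖Function.update z j w‖ ≤ r := by
    refine (pi_norm_le_iff_of_nonneg hr.le).2 fun i => ?_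
    rcases eq_or_ne i j with rfl | hij
    · simpa using hw
    · rw [Function.update_of_ne hij]
      linarith [norm_le_pi_norm z i, mem_ball_zero_iff.1 hz]
  have hupd (w : ℂ) : Differentiable ℂ fun z : Fin d → ℂ => Function.update z j w := by
    rw [differentiable_pi]
    intro i
    rcases eq_or_ne i j with rfl | hij
    · simp
    · simpa [Function.update_of_ne hij] using differentiable_apply i
  have hW_of {z : Fin d → ℂ} (hz : z ∈ U) {w : ℂ} (hw : ‖w‖ ≤ r) : Function.update z j w ∈ W :=
    hεW (mem_ball_zero_iff.2 ((hup hz hw).trans_lt hrε))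
  set F : (Fin d → ℂ) → ℝ → ℂ := fun z θ => deriv (circleMap 0 r) θ •
    (((circleMap 0 r θ)⁻¹ * (circleMap 0 r θ - z j)⁻¹) • g (Function.update z j (circleMap 0 r θ)))
    with hF
  have hcm (θ : ℝ) : ‖circleMap 0 r θ‖ = r := by simp [abs_of_pos hr]
  have hne {z : Fin d → ℂ} (hz : z ∈ U) (θ : ℝ) : r / 2 ≤ ‖circleMap 0 r θ - z j‖ := by
    have := norm_sub_norm_le (circleMap 0 r θ) (z j)
    rw [hcm] at this
    linarith [norm_le_pi_norm z j, mem_ball_zero_iff.1 hz]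
  have hne0 {z : Fin d → ℂ} (hz : z ∈ U) (θ : ℝ) : circleMap 0 r θ - z j ≠ 0 :=
    norm_pos_iff.1 (lt_of_lt_of_le (by positivity) (hne hz θ))
  have hgu {z : Fin d → ℂ} (hz : z ∈ U) :
      DifferentiableOn ℂ (fun w => g (Function.update z j w)) (Metric.closedBall 0 r) := by
    refine hd.comp ?_ fun w hw => hW_of hz (by simpa using hw)
    rw [differentiableOn_pi]
    intro i
    rcases eq_or_ne i j with rfl | hij
    · simp only [Function.update_self]
      fun_prop
    · simp [Function.update_of_ne hij]
  have hFc {z : Fin d → ℂ} (hz : z ∈ U) : Continuous (F z) := by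
    have h1 : Continuous fun θ => g (Function.update z j (circleMap 0 r θ)) :=
      (hgu hz).continuousOn.comp_continuous (continuous_circleMap 0 r) fun θ => by simp [hcm]
    have h2 : Continuous fun θ => (circleMap 0 r θ)⁻¹ * (circleMap 0 r θ - z j)⁻¹ :=
      ((continuous_circleMap 0 r).inv₀ fun θ => norm_pos_iff.1 (by rw [hcm]; exact hr)).mul
        (((continuous_circleMap 0 r).sub continuous_const).inv₀ (hne0 hz))
    have h3 : Continuous (deriv (circleMap 0 r)) := by
      simp only [funext (deriv_circleMap 0 r)]
      exact (continuous_circleMap 0 r).mul continuous_const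
    exact h3.smul (h2.smul h1)
  have hdiff : DifferentiableOn ℂ (fun z => ∮ w in C(0, r),
      (w⁻¹ * (w - z j)⁻¹) • g (Function.update z j w)) U := by
    simp only [circleIntegral, intervalIntegral.integral_of_le Real.two_pi_pos.le]
    refine differentiableOn_integral_of_bounded (F := F) Metric.isOpen_ball
      (fun z hz => (hFc hz).aestronglyMeasurable) (fun θ => ?_)
      (C := r * ((r⁻¹ * (r / 2)⁻¹) * (‖g 0‖ + 1))) fun θ z hz => ?_
    · refine DifferentiableOn.fun_const_smul (DifferentiableOn.fun_smul ?_ ?_) _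
      · refine DifferentiableOn.const_mul (DifferentiableOn.inv ?_ fun z hz => hne0 hz θ) _
        exact (differentiableOn_const _).sub (differentiable_apply j).differentiableOn
      · exact hd.comp (hupd _).differentiableOn fun z hz => hW_of hz (hcm θ).le
    · simp only [hF]
      rw [norm_smul, norm_smul, norm_mul, norm_inv, norm_inv, hcm, deriv_circleMap, norm_mul,
        hcm, Complex.norm_I, mul_one]
      have := hδb _ (mem_ball_zero_iff.2 ((hup hz (hcm θ).le).trans_lt hrδ))
      have := hne hz θ
      gcongr
  refine ⟨fun z => (2 * Real.pi * Complex.I : ℂ)⁻¹ • ∮ w in C(0, r),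
    (w⁻¹ * (w - z j)⁻¹) • g (Function.update z j w),
    ⟨U, Metric.isOpen_ball, Metric.mem_ball_self (by positivity), hdiff.fun_const_smul _⟩, ?_⟩
  filter_upwards [Metric.ball_mem_nhds (0 : Fin d → ℂ) (by positivity : 0 < r / 2)] with z hz
  have hzj : ‖z j‖ < r := by linarith [norm_le_pi_norm z j, mem_ball_zero_iff.1 hz]
  have hpi : (2 * Real.pi * Complex.I : ℂ) ≠ 0 := by simp [Real.pi_ne_zero]
  have e1 := (hgu hz).circleIntegral_sub_inv_smul (w := z j) (by simpa using hzj)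
  have e0 := (hgu hz).circleIntegral_sub_inv_smul (w := 0) (by simpa using hr)
  rw [Function.update_eq_self] at e1
  have hgsph : ContinuousOn (fun w => g (Function.update z j w)) (Metric.sphere 0 r) :=
    (hgu hz).continuousOn.mono Metric.sphere_subset_closedBall
  have hci {a : ℂ} (ha : ‖a‖ < r) :
      CircleIntegrable (fun w => (w - a)⁻¹ • g (Function.update z j w)) 0 r := by
    refine ContinuousOn.circleIntegrable hr.le (ContinuousOn.fun_smul ?_ hgsph)
    refine ContinuousOn.inv₀ (by fun_prop) fun w hw => ?_
    rintro h
    rw [sub_eq_zero] at h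
    simp [h] at hw
    linarith
  have key : z j * ∮ w in C(0, r), (w⁻¹ * (w - z j)⁻¹) • g (Function.update z j w) =
      2 * Real.pi * Complex.I * (g z - g (Function.update z j 0)) := by
    rw [mul_sub, ← smul_eq_mul (2 * Real.pi * Complex.I : ℂ) (g z), ← e1,
      ← smul_eq_mul (2 * Real.pi * Complex.I : ℂ) (g _), ← e0, ← circleIntegral.integral_sub
      (hci hzj) (hci (by simpa using hr)), ← circleIntegral.integral_const_mul]
    refine circleIntegral.integral_congr hr.le fun w hw => ?_
    have hw0 : w ≠ 0 := by
      rintro rfl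
      simp at hw
      linarith
    have hw1 : w - z j ≠ 0 := by
      intro h
      rw [sub_eq_zero] at h
      simp [h] at hw
      linarith
    simp only [smul_eq_mul, sub_zero]
    field_simp
    ring
  rw [smul_eq_mul, mul_left_comm, key]
  field_simp
  ring

end Hadamard

section Decomposition

variable {d : ℕ} {g h u v : (Fin d → ℂ) → ℂ} {m : Fin d → ℕ} {α : ℝ}

theorem HolNear.exists_eq_zero_on_add_sum (hg : HolNear g 0) (S : Finset (Fin d)) :
    ∃ H : Fin d → (Fin d → ℂ) → ℂ, (∀ j, HolNear (H j) 0) ∧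
      ∀ᶠ z in 𝓝 0, g z = g (fun i => if i ∈ S then 0 else z i) + ∑ j ∈ S, z j * H j z := by
  induction S using Finset.induction_on with
  | empty =>
    exact ⟨fun _ _ => 0, fun _ => .of_differentiable (differentiable_const _), by simp⟩
  | insert j S hj ih =>
    obtain ⟨H, hH, hgH⟩ := ih
    have hP : Differentiable ℂ fun (z : Fin d → ℂ) i => if i ∈ S then 0 else z i := by
      rw [differentiable_pi]
      intro i
      split_ifs <;> fun_prop
    obtain ⟨q, hq, hgq⟩ := (hg.comp_differentiable hP (by ext; simp)).exists_eq_update_add_mul j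
    refine ⟨Function.update H j q, fun i => ?_, ?_⟩
    · rcases eq_or_ne i j with rfl | hij
      · simpa using hq
      · simpa [Function.update_of_ne hij] using hH i
    · filter_upwards [hgH, hgq] with z h1 h2
      have h3 : (fun i => if i ∈ S then 0 else Function.update z j 0 i) =
          fun i => if i ∈ insert j S then 0 else z i := by
        ext i
        rcases eq_or_ne i j with rfl | hij
        · simp
        · simp [hij]
      rw [h1, h2, h3, Finset.sum_insert hj, Function.update_self, add_assoc]
      congr 2
      refine Finset.sum_congr rfl fun i hi => ?_
      rw [Function.update_of_ne (by rintro rfl; exact hj hi)]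

/-- **Hadamard's lemma** for holomorphic functions. -/
theorem HolNear.exists_eq_const_add_sum (hg : HolNear g 0) :
    ∃ H : Fin d → (Fin d → ℂ) → ℂ, (∀ j, HolNear (H j) 0) ∧
      ∀ᶠ z in 𝓝 0, g z = g 0 + ∑ j, z j * H j z := by
  obtain ⟨H, hH, hgH⟩ := hg.exists_eq_zero_on_add_sum Finset.univ
  refine ⟨H, hH, ?_⟩
  filter_upwards [hgH] with z hz
  simpa [← Pi.zero_def] using hz

/-- The germ of `g` at `0` is in the ideal generated by the monomials `z ^ ν` with
`α < ∑ j, (ν j + 1) / m j`. -/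
def MemWeightIdeal (m : Fin d → ℕ) (α : ℝ) (g : (Fin d → ℂ) → ℂ) : Prop :=
  ∃ (k : ℕ) (ν : Fin k → Fin d → ℕ) (h : Fin k → (Fin d → ℂ) → ℂ),
    (∀ i : Fin k, HolNear (h i) 0 ∧ α < ∑ j : Fin d, ((ν i j : ℝ) + 1) / (m j : ℝ)) ∧
    g =ᶠ[𝓝 0] fun z => ∑ i : Fin k, h i z * ∏ j : Fin d, z j ^ ν i j

theorem MemWeightIdeal.zero : MemWeightIdeal m α fun _ => 0 :=
  ⟨0, Fin.elim0, Fin.elim0, fun i => i.elim0, by simp⟩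

theorem MemWeightIdeal.monomial {ν : Fin d → ℕ} (hν : α < ∑ j, ((ν j : ℝ) + 1) / m j)
    (hh : HolNear h 0) : MemWeightIdeal m α fun z => h z * ∏ j, z j ^ ν j :=
  ⟨1, fun _ => ν, fun _ => h, fun _ => ⟨hh, hν⟩, by simp⟩

theorem MemWeightIdeal.add (hu : MemWeightIdeal m α u) (hv : MemWeightIdeal m α v) :
    MemWeightIdeal m α fun z => u z + v z := by
  obtain ⟨k, ν, h, hh, hu⟩ := hu
  obtain ⟨k', ν', h', hh', hv⟩ := hv
  refine ⟨k + k', Fin.append ν ν', Fin.append h h', fun i => ?_, ?_⟩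
  · refine Fin.addCases (fun i => ?_) (fun i => ?_) i
    · simpa using hh i
    · simpa using hh' i
  · filter_upwards [hu, hv] with z h1 h2
    simp [Fin.sum_univ_add, h1, h2]

theorem MemWeightIdeal.multCond {f : (Fin d → ℂ) → ℂ} (hf : f = fun z => ∑ j, z j ^ m j)
    (hm : ∀ j, 0 < m j) (hα0 : 0 < α) (hα1 : α < 1) (hu : MemWeightIdeal m α u) :
    MultCond f Set.univ u 0 α := by
  subst hf
  obtain ⟨k, ν, h, hh, hu⟩ := hu
  have hf : Measurable fun z : Fin d → ℂ => ∑ j, z j ^ m j := by fun_prop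
  exact (MultCond.sum hf _ fun i _ =>
    (multCond_monomial hm hα0 hα1 (hh i).2).mul_left_s10 hf (hh i).1).congr hf hu

/-- The exponents in the box `ν j < m j` with `∑ j, (ν j + 1) / m j ≤ α`. -/
def smallExponents (m : Fin d → ℕ) (α : ℝ) : Finset (Fin d → ℕ) :=
  {ν ∈ Fintype.piFinset fun j => Finset.range (m j) | ∑ j, ((ν j : ℝ) + 1) / m j ≤ α}

theorem mem_smallExponents (hm : ∀ j, 0 < m j) (hα1 : α < 1) {ν : Fin d → ℕ} :
    ν ∈ smallExponents m α ↔ ∑ j, ((ν j : ℝ) + 1) / m j ≤ α := by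
  simp only [smallExponents, Finset.mem_filter, Fintype.mem_piFinset, Finset.mem_range,
    and_iff_right_iff_imp]
  intro h j
  have h1 : ((ν j : ℝ) + 1) / m j ≤ ∑ j, ((ν j : ℝ) + 1) / m j :=
    Finset.single_le_sum (f := fun j => ((ν j : ℝ) + 1) / m j) (fun _ _ => by positivity)
      (Finset.mem_univ j)
  have h2 : ((ν j : ℝ) + 1) / m j < 1 := by linarith
  rw [div_lt_one (by exact_mod_cast hm j)] at h2
  exact_mod_cast (by linarith : (ν j : ℝ) < m j)

/-- Membership in the sum of the span of the small monomials and the ideal generated by the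
others. -/
def IsDecomposable (m : Fin d → ℕ) (α : ℝ) (g : (Fin d → ℂ) → ℂ) : Prop :=
  ∃ (c : (Fin d → ℕ) → ℂ) (u : (Fin d → ℂ) → ℂ), MemWeightIdeal m α u ∧
    ∀ᶠ z in 𝓝 0, g z = ∑ ν ∈ smallExponents m α, c ν * ∏ j, z j ^ ν j + u z

theorem IsDecomposable.add (hu : IsDecomposable m α u) (hv : IsDecomposable m α v) :
    IsDecomposable m α fun z => u z + v z := by
  obtain ⟨c, a, ha, hu⟩ := hu
  obtain ⟨c', a', ha', hv⟩ := hv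
  refine ⟨fun ν => c ν + c' ν, _, ha.add ha', ?_⟩
  filter_upwards [hu, hv] with z h1 h2
  rw [h1, h2]
  simp only [add_mul, Finset.sum_add_distrib]
  ring

theorem MemWeightIdeal.isDecomposable (hu : MemWeightIdeal m α u) : IsDecomposable m α u :=
  ⟨fun _ => 0, u, hu, by simp⟩

theorem IsDecomposable.sum {ι : Type*} (s : Finset ι) {G : ι → (Fin d → ℂ) → ℂ}
    (hG : ∀ i ∈ s, IsDecomposable m α (G i)) : IsDecomposable m α fun z => ∑ i ∈ s, G i z := by
  classical
  induction s using Finset.induction_on with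
  | empty => simpa using MemWeightIdeal.zero.isDecomposable
  | insert i s hi ih =>
    simp only [Finset.sum_insert hi]
    exact (hG i (by simp)).add (ih fun j hj => hG j (by simp [hj]))

theorem IsDecomposable.congr (hu : IsDecomposable m α u) (huv : ∀ᶠ z in 𝓝 0, v z = u z) :
    IsDecomposable m α v := by
  obtain ⟨c, a, ha, hu⟩ := hu
  refine ⟨c, a, ha, ?_⟩
  filter_upwards [hu, huv] with z h1 h2
  rw [h2, h1]

theorem isDecomposable_const_mul_monomial {ν : Fin d → ℕ} (hν : ν ∈ smallExponents m α) (a : ℂ) :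
    IsDecomposable m α fun z => a * ∏ j, z j ^ ν j := by
  classical
  exact ⟨Pi.single ν a, _, MemWeightIdeal.zero, Eventually.of_forall fun z => by
    simp [Pi.single_apply, hν]⟩

theorem isDecomposable_mul_monomial (hm : ∀ j, 0 < m j) (hα1 : α < 1) (n : ℕ) :
    ∀ (ν : Fin d → ℕ) (h : (Fin d → ℂ) → ℂ), HolNear h 0 → ∑ j, m j < ∑ j, ν j + n →
      IsDecomposable m α fun z => h z * ∏ j, z j ^ ν j := by
  induction n with
  | zero =>
    intro ν h hh hn
    refine (MemWeightIdeal.monomial ?_ hh).isDecomposable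
    by_contra! hν
    rw [← mem_smallExponents hm hα1] at hν
    simp only [smallExponents, Finset.mem_filter, Fintype.mem_piFinset, Finset.mem_range] at hν
    have := Finset.sum_le_sum fun j (_ : j ∈ Finset.univ) => (hν.1 j).le
    omega
  | succ n ih =>
    intro ν h hh hn
    rcases lt_or_ge α (∑ j, ((ν j : ℝ) + 1) / m j) with hν | hν
    · exact (MemWeightIdeal.monomial hν hh).isDecomposable
    rw [← mem_smallExponents hm hα1] at hν
    obtain ⟨H, hH, hhH⟩ := hh.exists_eq_const_add_sum
    refine ((isDecomposable_const_mul_monomial hν (h 0)).add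
      (IsDecomposable.sum Finset.univ fun j _ => ih (ν + Pi.single j 1) (H j) (hH j) ?_)).congr ?_
    · simp only [Pi.add_apply, Finset.sum_add_distrib, Finset.sum_pi_single', Finset.mem_univ,
        if_true]
      omega
    · filter_upwards [hhH] with z hz
      rw [hz, add_mul, Finset.sum_mul]
      congr 1
      refine Finset.sum_congr rfl fun j _ => ?_
      have : ∏ i, z i ^ (Pi.single j 1 : Fin d → ℕ) i = z j := by
        rw [Finset.prod_eq_single j (fun i _ hij => by simp [hij]) (by simp)]
        simp
      simp only [Pi.add_apply, pow_add, Finset.prod_mul_distrib, this]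
      ring

theorem HolNear.isDecomposable (hm : ∀ j, 0 < m j) (hα1 : α < 1) (hg : HolNear g 0) :
    IsDecomposable m α g := by
  simpa using isDecomposable_mul_monomial hm hα1 (∑ j, m j + 1) 0 g hg (by simp)

end Decomposition

section Averaging

variable {d : ℕ} {m : Fin d → ℕ} {α : ℝ}

theorem IsPrimitiveRoot.sum_range_pow_div_pow {k : ℕ} {ω : ℂ} (hω : IsPrimitiveRoot ω k) {a b : ℕ}
    (ha : a < k) (hb : b < k) :
    ∑ t ∈ Finset.range k, (ω ^ t) ^ a * ((ω ^ t)⁻¹) ^ b = if a = b then (k : ℂ) else 0 := by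
  have h0 : ω ≠ 0 := hω.ne_zero (by omega)
  have : ∀ t, (ω ^ t) ^ a * ((ω ^ t)⁻¹) ^ b = (ω ^ a / ω ^ b) ^ t := fun t => by
    rw [inv_pow, div_pow, ← pow_mul, ← pow_mul, ← pow_mul, ← pow_mul, mul_comm t, mul_comm t,
      div_eq_mul_inv]
  simp only [this]
  split_ifs with hab
  · simp [hab, h0]
  · have h1 : ω ^ a / ω ^ b ≠ 1 := fun h =>
      hab (hω.pow_inj ha hb ((div_eq_one_iff_eq (pow_ne_zero _ h0)).1 h))
    rw [geom_sum_eq h1, div_pow, ← pow_mul, ← pow_mul, mul_comm a, mul_comm b, pow_mul, pow_mul,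
      hω.pow_eq_one]
    simp

theorem MultCond.comp_rotation {f g : (Fin d → ℂ) → ℂ} (hg : MultCond f Set.univ g 0 α)
    {a : Fin d → ℂ} (ha : ∀ j, ‖a j‖ = 1) (hfa : ∀ z, f (fun j => a j * z j) = f z) :
    MultCond f Set.univ (fun z => g fun j => a j * z j) 0 α := by
  have h0 (j : Fin d) : a j ≠ 0 := norm_pos_iff.1 (by simp [ha j])
  refine hg.comp_measurePreserving (by fun_prop) (by ext; simp) ?_ hfa ?_
  · refine volume_preserving_pi fun j => ?_
    let e : ℂ ≃ₗᵢ[ℝ] ℂ := (rotation ⟨a j, by simp [Submonoid.unitSphere, ha j]⟩)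
    exact e.measurePreserving
  · exact (MeasurableEquiv.piCongrRight fun j =>
      MeasurableEquiv.mulLeft₀ (a j) (h0 j)).measurableEmbedding

theorem MultCond.monomial_of_sum {f : (Fin d → ℂ) → ℂ} (hf : f = fun z => ∑ j, z j ^ m j)
    (hm : ∀ j, 0 < m j) {s : Finset (Fin d → ℕ)}
    (hs : ∀ ν ∈ s, ∀ j, ν j < m j) {c : (Fin d → ℕ) → ℂ}
    (h : MultCond f Set.univ (fun z => ∑ ν ∈ s, c ν * ∏ j, z j ^ ν j) 0 α)
    {κ : Fin d → ℕ} (hκ : κ ∈ s) (hc : c κ ≠ 0) :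
    MultCond f Set.univ (fun z => ∏ j, z j ^ κ j) 0 α := by
  have hfm : Measurable f := by subst hf; fun_prop
  let ω : Fin d → ℂ := fun j => Complex.exp (2 * Real.pi * Complex.I / m j)
  have hω (j : Fin d) : IsPrimitiveRoot (ω j) (m j) :=
    Complex.isPrimitiveRoot_exp _ (hm j).ne'
  have key (z : Fin d → ℂ) :
      ∑ γ ∈ Fintype.piFinset fun j => Finset.range (m j), (∏ j, ((ω j ^ γ j)⁻¹) ^ κ j) *
        ∑ ν ∈ s, c ν * ∏ j, (ω j ^ γ j * z j) ^ ν j =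
      ((∏ j, (m j : ℂ)) * c κ) * ∏ j, z j ^ κ j := by
    calc _ = ∑ ν ∈ s, c ν * (∏ j, z j ^ ν j) * ∑ γ ∈ Fintype.piFinset fun j => Finset.range (m j),
          ∏ j, ((ω j ^ γ j) ^ ν j * ((ω j ^ γ j)⁻¹) ^ κ j) := by
          simp only [Finset.mul_sum]
          rw [Finset.sum_comm]
          refine Finset.sum_congr rfl fun ν _ => Finset.sum_congr rfl fun γ _ => ?_
          simp only [mul_pow, Finset.prod_mul_distrib]
          ring
      _ = ∑ ν ∈ s, c ν * (∏ j, z j ^ ν j) * ∏ j, if ν j = κ j then (m j : ℂ) else 0 := by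
          refine Finset.sum_congr rfl fun ν hν => ?_
          rw [← Finset.prod_univ_sum (fun j => Finset.range (m j))
            fun j t => (ω j ^ t) ^ ν j * ((ω j ^ t)⁻¹) ^ κ j]
          congr 1
          exact Finset.prod_congr rfl fun j _ =>
            (hω j).sum_range_pow_div_pow (hs ν hν j) (hs κ hκ j)
      _ = _ := by
          rw [Finset.sum_eq_single_of_mem κ hκ]
          · simp only [if_true]
            ring
          · intro ν _ hν
            obtain ⟨j, hj⟩ := Function.ne_iff.1 hν
            rw [Finset.prod_eq_zero (f := fun j => if ν j = κ j then (m j : ℂ) else 0) (Finset.mem_univ j) (if_neg hj), mul_zero]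
  have hne : (∏ j, (m j : ℂ)) * c κ ≠ 0 :=
    mul_ne_zero (Finset.prod_ne_zero_iff.2 fun j _ => by exact_mod_cast (hm j).ne') hc
  have hsum := MultCond.sum hfm (Fintype.piFinset fun j => Finset.range (m j)) fun γ _ =>
    (h.comp_rotation (a := fun j => ω j ^ γ j)
      (fun j => by rw [norm_pow, (hω j).norm'_eq_one (hm j).ne', one_pow]) (fun z => by
        subst hf
        refine Finset.sum_congr rfl fun j _ => ?_
        rw [mul_pow, ← pow_mul, mul_comm (γ j), pow_mul, (hω j).pow_eq_one, one_pow,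
          one_mul])).mul_left_s10 hfm
      (h := fun _ => ∏ j, ((ω j ^ γ j)⁻¹) ^ κ j)
      (.of_differentiable (differentiable_const _))
  refine (hsum.mul_left_s10 hfm (h := fun _ => ((∏ j, (m j : ℂ)) * c κ)⁻¹)
    (.of_differentiable (differentiable_const _))).congr hfm (Eventually.of_forall fun z => ?_)
  simp only [key]
  rw [inv_mul_cancel_left₀ hne]

end Averaging

section Scaling

variable {d : ℕ} {m : Fin d → ℕ} {α : ℝ}

theorem volume_eq_smul_map_mul {c : Fin d → ℝ} (hc : ∀ j, 0 < c j) :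
    (volume : Measure (Fin d → ℂ)) = ENNReal.ofReal (∏ j, c j ^ 2) •
      Measure.map (fun (z : Fin d → ℂ) j => (c j : ℂ) * z j) volume := by
  rw [volume_pi]
  refine Measure.pi_eq fun s hs => ?_
  have hpre : (fun (z : Fin d → ℂ) j => (c j : ℂ) * z j) ⁻¹' Set.univ.pi s =
      Set.univ.pi fun j => (fun z : ℂ => c j • z) ⁻¹' s j := by
    ext z
    simp
  rw [Measure.smul_apply, Measure.map_apply (by fun_prop) (MeasurableSet.univ_pi hs), hpre,
    Measure.pi_pi, ENNReal.ofReal_prod_of_nonneg (fun _ _ => by positivity), smul_eq_mul,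
    ← Finset.prod_mul_distrib]
  refine Finset.prod_congr rfl fun j _ => ?_
  rw [Measure.addHaar_preimage_smul _ (hc j).ne', Complex.finrank_real_complex, ← mul_assoc,
    ← ENNReal.ofReal_mul (by positivity), abs_of_pos (by have := hc j; positivity),
    mul_inv_cancel₀ (by have := hc j; positivity), ENNReal.ofReal_one, one_mul]

/-- The multiplier condition for a monomial forces the weight inequality, by quasi-homogeneity. -/
theorem lt_of_multCond_monomial (hd : 1 ≤ d) (hm : ∀ j, 0 < m j) {ν : Fin d → ℕ}
    (h : MultCond (fun z : Fin d → ℂ => ∑ j, z j ^ m j) Set.univ (fun z => ∏ j, z j ^ ν j) 0 α) :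
    α < ∑ j, ((ν j : ℝ) + 1) / m j := by
  by_contra! hle
  obtain ⟨V, hV, hV0, -, -, hi⟩ := h
  obtain ⟨ε, hε, hεV⟩ := Metric.isOpen_iff.1 hV 0 hV0
  obtain ⟨ρ, hρ, hρε⟩ : ∃ ρ : ℝ, 0 < ρ ∧ ∀ j, ρ ≤ ε ^ m j := by
    refine ⟨min ε 1 ^ ∑ j, m j, by positivity, fun j => ?_⟩
    calc min ε 1 ^ ∑ j, m j ≤ min ε 1 ^ m j :=
          pow_le_pow_of_le_one (by positivity) (min_le_right _ _)
            (Finset.single_le_sum (f := m) (fun _ _ => Nat.zero_le _) (Finset.mem_univ j))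
      _ ≤ ε ^ m j := by gcongr; exact min_le_left _ _
  set Φ : (Fin d → ℂ) → ℝ :=
    fun z => ‖∏ j, z j ^ ν j‖ ^ 2 / ‖∑ j, z j ^ m j‖ ^ (2 * α) with hΦ
  let B : ℝ → Set (Fin d → ℂ) := fun t => {z | ∀ j, ‖z j‖ ^ m j < t}
  have hBo (t : ℝ) : IsOpen (B t) := by
    simp only [B, Set.ofPred_forall]
    exact isOpen_iInter_of_finite fun j => isOpen_lt (by fun_prop) continuous_const
  have hBV : B ρ ⊆ V := fun z hz => hεV <| mem_ball_zero_iff.2 <|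
    (pi_norm_lt_iff hε).2 fun j => lt_of_pow_lt_pow_left₀ (m j) hε.le ((hz j).trans_le (hρε j))
  have hBB : B (ρ / 2) ⊆ B ρ := fun z hz j => (hz j).trans (by linarith)
  have hiB : IntegrableOn Φ (B ρ) := hi.mono_set hBV
  set c : Fin d → ℝ := fun j => 2 ^ (-(1 / m j : ℝ)) with hc
  have hc0 (j : Fin d) : 0 < c j := by positivity
  have hcm (j : Fin d) : c j ^ m j = 1 / 2 := by
    rw [hc, ← Real.rpow_mul_natCast (by norm_num)]
    have : (m j : ℝ) ≠ 0 := by exact_mod_cast (hm j).ne'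
    rw [show -(1 / (m j : ℝ)) * m j = -1 by field_simp, Real.rpow_neg_one]
    norm_num
  set T : (Fin d → ℂ) → Fin d → ℂ := fun z j => (c j : ℂ) * z j with hT
  have hTe : MeasurableEmbedding T := (MeasurableEquiv.piCongrRight fun j =>
    MeasurableEquiv.mulLeft₀ (c j : ℂ) (by exact_mod_cast (hc0 j).ne')).measurableEmbedding
  have hTB : T ⁻¹' B (ρ / 2) = B ρ := by
    ext z
    simp only [Set.mem_preimage, B, Set.mem_ofPred_eq, hT, norm_mul, mul_pow, Complex.norm_real,
      Real.norm_of_nonneg (hc0 _).le, hcm]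
    exact forall_congr' fun j => ⟨fun h => by linarith, fun h => by linarith⟩
  have hΦT (z : Fin d → ℂ) : Φ (T z) = (∏ j, c j ^ (2 * ν j)) * 2 ^ (2 * α) * Φ z := by
    have h1 : ∑ j, T z j ^ m j = (1 / 2 : ℝ) * ∑ j, z j ^ m j := by
      rw [Finset.mul_sum]
      refine Finset.sum_congr rfl fun j _ => ?_
      rw [hT, mul_pow, ← Complex.ofReal_pow, hcm]
    have h2 : ‖∏ j, T z j ^ ν j‖ ^ 2 = (∏ j, c j ^ (2 * ν j)) * ‖∏ j, z j ^ ν j‖ ^ 2 := by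
      simp only [hT, mul_pow, Finset.prod_mul_distrib, norm_mul]
      congr 1
      rw [norm_prod, ← Finset.prod_pow]
      refine Finset.prod_congr rfl fun j _ => ?_
      rw [norm_pow, Complex.norm_real, Real.norm_of_nonneg (hc0 _).le]
      ring
    simp only [hΦ]
    rw [h1, h2, norm_mul, Complex.norm_real, Real.norm_of_nonneg (by norm_num),
      Real.mul_rpow (by norm_num) (norm_nonneg _), one_div, Real.inv_rpow (by norm_num)]
    field_simp
  have hscale : ∫ z in B (ρ / 2), Φ z =
      2 ^ (2 * α - 2 * ∑ j, ((ν j : ℝ) + 1) / m j) * ∫ z in B ρ, Φ z := by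
    calc ∫ z in B (ρ / 2), Φ z = (∏ j, c j ^ 2) *
          ∫ z in B (ρ / 2), Φ z ∂(Measure.map T volume) := by
          conv_lhs => rw [volume_eq_smul_map_mul hc0]
          rw [Measure.restrict_smul, integral_smul_measure, ENNReal.toReal_ofReal (by positivity),
            smul_eq_mul]
      _ = (∏ j, c j ^ 2) * ((∏ j, c j ^ (2 * ν j)) * 2 ^ (2 * α) * ∫ z in B ρ, Φ z) := by
          rw [hTe.setIntegral_map, hTB]
          simp only [hΦT, integral_const_mul]
      _ = _ := by
          rw [← mul_assoc, ← mul_assoc, ← Finset.prod_mul_distrib, sub_eq_add_neg,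
            Real.rpow_add (by norm_num), mul_comm ((2 : ℝ) ^ (2 * α)), Finset.mul_sum,
            ← Finset.sum_neg_distrib, Real.rpow_sum_of_pos (by norm_num)]
          congr 2
          refine Finset.prod_congr rfl fun j _ => ?_
          rw [← pow_add, hc, ← Real.rpow_mul_natCast (by norm_num)]
          congr 1
          push_cast
          ring
  have hΦ0 (z : Fin d → ℂ) : 0 ≤ Φ z := by positivity
  have hpos : 0 < ∫ z in B ρ \ B (ρ / 2), Φ z := by
    rw [setIntegral_pos_iff_support_of_nonneg_ae (Eventually.of_forall hΦ0)
      (hiB.mono_set Set.sdiff_subset)]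
    let O : Set (Fin d → ℂ) := B ρ ∩ {z | ρ / 2 < ‖z ⟨0, hd⟩‖ ^ m ⟨0, hd⟩} ∩
      ({z | ∏ j, z j ^ ν j ≠ 0} ∩ {z | ∑ j, z j ^ m j ≠ 0})
    have hO : IsOpen O := ((hBo ρ).inter (isOpen_lt continuous_const (by fun_prop))).inter
      ((isOpen_ne_fun (by fun_prop) continuous_const).inter
        (isOpen_ne_fun (by fun_prop) continuous_const))
    have hOne : O.Nonempty := by
      have hpow (j : Fin d) : ((3 / 4 * ρ) ^ (1 / m j : ℝ)) ^ m j = 3 / 4 * ρ := by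
        rw [one_div, Real.rpow_inv_natCast_pow (by positivity) (hm j).ne']
      have hnorm (j : Fin d) : ‖(((3 / 4 * ρ) ^ (1 / m j : ℝ) : ℝ) : ℂ)‖ ^ m j = 3 / 4 * ρ := by
        rw [Complex.norm_real, Real.norm_of_nonneg (by positivity), hpow]
      refine ⟨fun j => (((3 / 4 * ρ) ^ (1 / m j : ℝ) : ℝ) : ℂ), ⟨fun j => ?_, ?_⟩, ?_, ?_⟩
      · rw [hnorm]
        linarith
      · simp only [Set.mem_ofPred_eq, hnorm]
        linarith
      · exact Finset.prod_ne_zero_iff.2 fun j _ => pow_ne_zero _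
          (Complex.ofReal_ne_zero.2 (by positivity))
      · simp only [Set.mem_ofPred_eq, ← Complex.ofReal_pow, hpow]
        have : (d : ℂ) ≠ 0 := by exact_mod_cast (by omega : d ≠ 0)
        simp [this, hρ.ne']
    refine (hO.measure_pos volume hOne).trans_le (measure_mono ?_)
    rintro z ⟨⟨hz, hz1⟩, hz2, hz3⟩
    refine ⟨?_, hz, fun hz4 => lt_asymm hz1 (hz4 _)⟩
    have h1 := norm_pos_iff.2 hz2
    have h2 := norm_pos_iff.2 hz3
    exact (by positivity : 0 < Φ z).ne'
  rw [setIntegral_sdiff (hBo _).measurableSet hiB hBB, hscale] at hpos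
  have h1 : (1 : ℝ) ≤ 2 ^ (2 * α - 2 * ∑ j, ((ν j : ℝ) + 1) / m j) :=
    Real.one_le_rpow (by norm_num) (by linarith)
  have h2 : 0 ≤ ∫ z in B ρ, Φ z := integral_nonneg hΦ0
  nlinarith

end Scaling
/-- Restriction to `α ∈ (0,1)` of (2.6.4–5): for a Brieskorn–Pham polynomial
`f = z₁^{m₁} + ⋯ + z_d^{m_d}` and rational `α ∈ (0,1)`, the multiplier ideal germ
`𝒥(f^α)_0` is the monomial ideal generated by the `z^ν` with `Σⱼ (νⱼ+1)/mⱼ > α`;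
in particular `z^ν ∈ 𝒥(f^α)_0` iff `Σⱼ (νⱼ+1)/mⱼ > α`. -/
theorem multiplier_ideal_brieskorn_pham
    (d : ℕ) (hd : 1 ≤ d) (m : Fin d → ℕ) (hm : ∀ j, 2 ≤ m j)
    (f : (Fin d → ℂ) → ℂ) (hf : f = fun z => ∑ j : Fin d, z j ^ m j)
    (α : ℚ) (hα0 : 0 < α) (hα1 : α < 1) :
    (∀ g : (Fin d → ℂ) → ℂ, HolNear g 0 →
      (MultCond f Set.univ g 0 (α : ℝ) ↔
        ∃ (k : ℕ) (ν : Fin k → Fin d → ℕ) (h : Fin k → (Fin d → ℂ) → ℂ),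
          (∀ i : Fin k, HolNear (h i) 0 ∧
            (α : ℝ) < ∑ j : Fin d, ((ν i j : ℝ) + 1) / (m j : ℝ)) ∧
          g =ᶠ[𝓝 0] fun z => ∑ i : Fin k, h i z * ∏ j : Fin d, z j ^ ν i j)) ∧
    (∀ ν : Fin d → ℕ,
      MultCond f Set.univ (fun z => ∏ j : Fin d, z j ^ ν j) 0 (α : ℝ) ↔
        (α : ℝ) < ∑ j : Fin d, ((ν j : ℝ) + 1) / (m j : ℝ)) := by
  have hm0 (j : Fin d) : 0 < m j := zero_lt_two.trans_le (hm j)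
  have hα0' : (0 : ℝ) < α := by exact_mod_cast hα0
  have hα1' : (α : ℝ) < 1 := by exact_mod_cast hα1
  have hfm : Measurable f := by subst hf; fun_prop
  have hmon (ν : Fin d → ℕ) (h : MultCond f Set.univ (fun z => ∏ j, z j ^ ν j) 0 (α : ℝ)) :
      (α : ℝ) < ∑ j, ((ν j : ℝ) + 1) / m j := by
    subst hf
    exact lt_of_multCond_monomial hd hm0 h
  refine ⟨fun g hg => ⟨fun hgα => ?_, fun hgI => MemWeightIdeal.multCond hf hm0 hα0' hα1' hgI⟩,
    fun ν => ⟨hmon ν, fun hν => hf ▸ multCond_monomial hm0 hα0' hα1' hν⟩⟩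
  obtain ⟨c, u, hu, hgu⟩ := hg.isDecomposable hm0 hα1'
  have hP : MultCond f Set.univ
      (fun z => ∑ ν ∈ smallExponents m α, c ν * ∏ j, z j ^ ν j) 0 (α : ℝ) := by
    refine (hgα.add hfm ((hu.multCond hf hm0 hα0' hα1').mul_left_s10 hfm (h := fun _ => -1)
      (.of_differentiable (differentiable_const _)))).congr hfm ?_
    filter_upwards [hgu] with z hz
    rw [hz]
    ring
  have hc (κ : Fin d → ℕ) (hκ : κ ∈ smallExponents m (α : ℝ)) : c κ = 0 := by
    by_contra hne
    refine (hmon κ (hP.monomial_of_sum hf hm0 (fun ν hν j => ?_) hκ hne)).not_ge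
      ((mem_smallExponents hm0 hα1').1 hκ)
    exact Finset.mem_range.1 (Fintype.mem_piFinset.1 (Finset.mem_filter.1 hν).1 j)
  obtain ⟨k, ν, h, hh, hu⟩ := hu
  refine ⟨k, ν, h, hh, ?_⟩
  filter_upwards [hgu, hu] with z h1 h2
  rw [h1, Finset.sum_eq_zero fun κ hκ => by rw [hc κ hκ, zero_mul], zero_add, h2]
end
end
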